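/- Let I ⊂ S be a quadratic monomial ideal. If I has a linear resolution, then every power I^k (k ≥ 1) has linear quotients; in particular I^k has a 2k-linear resolution for all k ≥ 1. -/

import Mathlib

open MvPolynomial

/-- `I` has a `d`-linear (free) resolution: there is a resolution
`... → S^{r 2} → S^{r 1} → S^{r 0} → I → 0` in which the generators of `S^{r 0}` map to
homogeneous generators of `I` of degree `d` and all matrices have entries which are
homogeneous of degree `1`.  (Its existence is equivalent to all graded Betti numbers
`β_{i,j}(I)` vanishing for `j ≠ i + d`.) -/
def HasLinearResolution {K : Type*} [Field K] {σ : Type*}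
    (I : Ideal (MvPolynomial σ K)) (d : ℕ) : Prop :=
  ∃ (r : ℕ → ℕ) (g : Fin (r 0) → MvPolynomial σ K)
    (M : (i : ℕ) → Fin (r i) → Fin (r (i + 1)) → MvPolynomial σ K),
    (∀ j, (g j).IsHomogeneous d) ∧
    I = Ideal.span (Set.range g) ∧
    (∀ i j k, (M i j k).IsHomogeneous 1) ∧
    (∀ v : Fin (r 0) → MvPolynomial σ K,
      (∑ j, v j * g j) = 0 ↔
        ∃ w : Fin (r 1) → MvPolynomial σ K, v = fun j => ∑ k, M 0 j k * w k) ∧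
    (∀ (i : ℕ) (v : Fin (r (i + 1)) → MvPolynomial σ K),
      ((fun j => ∑ k, M i j k * v k) = fun _ => 0) ↔
        ∃ w : Fin (r (i + 2)) → MvPolynomial σ K, v = fun k => ∑ l, M (i + 1) k l * w l)

/-- A monomial ideal `I` has linear quotients: there is an ordering `u 0 > u 1 > ...`
of its minimal monomial generators (given by exponent vectors) such that each colon
ideal `(u 0, ..., u (i-1)) : u i` is generated by variables. -/
def HasLinearQuotients {K : Type*} [Field K] {n : ℕ}
    (I : Ideal (MvPolynomial (Fin n) K)) : Prop :=
  ∃ (m : ℕ) (u : Fin m → (Fin n →₀ ℕ)),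
    (∀ i j : Fin m, u i ≤ u j → i = j) ∧
    I = Ideal.span (Set.range fun i => (MvPolynomial.monomial (u i) (1 : K) :
      MvPolynomial (Fin n) K)) ∧
    ∀ i : Fin m, ∃ s : Set (Fin n),
      Submodule.colon
          (Ideal.span ((fun j => (MvPolynomial.monomial (u j) (1 : K) :
            MvPolynomial (Fin n) K)) '' {j : Fin m | j < i}))
          (Ideal.span {(MvPolynomial.monomial (u i) (1 : K) : MvPolynomial (Fin n) K)})
        = Ideal.span ((fun x => (MvPolynomial.X x : MvPolynomial (Fin n) K)) '' s)

section EdgeProducts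

variable {V α : Type*}

/-- The exponent vector of a product of edges, each edge `e` having exponent vector `ev e`. -/
noncomputable def edgeSum (ev : α → V →₀ ℕ) (R : Multiset α) : V →₀ ℕ := (R.map ev).sum

@[simp] lemma edgeSum_zero (ev : α → V →₀ ℕ) : edgeSum ev 0 = 0 := by simp [edgeSum]

@[simp] lemma edgeSum_cons (ev : α → V →₀ ℕ) (e : α) (R : Multiset α) :
    edgeSum ev (e ::ₘ R) = ev e + edgeSum ev R := by simp [edgeSum]

@[simp] lemma edgeSum_add (ev : α → V →₀ ℕ) (R T : Multiset α) :
    edgeSum ev (R + T) = edgeSum ev R + edgeSum ev T := by simp [edgeSum]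

lemma degree_edgeSum {ev : α → V →₀ ℕ} (hev : ∀ e, (ev e).degree = 2) (R : Multiset α) :
    (edgeSum ev R).degree = 2 * R.card := by
  induction R using Multiset.induction_on with
  | empty => simp
  | cons e R ih => simp [map_add, hev, ih]; ring

/-- An edge of the multiset through a vertex of positive degree. -/
lemma exists_edge_through {ev : α → V →₀ ℕ}
    (hev : ∀ e, ∃ p q, ev e = Finsupp.single p 1 + Finsupp.single q 1)
    {R : Multiset α} {x : V} (hx : edgeSum ev R x ≠ 0) :
    ∃ e R' y, R = e ::ₘ R' ∧ ev e = Finsupp.single x 1 + Finsupp.single y 1 := by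
  classical
  have : ∃ e ∈ R, ev e x ≠ 0 := by
    by_contra! h
    apply hx
    induction R using Multiset.induction_on with
    | empty => simp
    | cons e R ih =>
      have h1 := h e (by simp)
      have h2 : edgeSum ev R x = 0 := by
        by_contra h3
        exact h3 (ih h3 fun f hf => h f (by simp [hf]))
      simp [h1, h2]
  obtain ⟨e, he, hex⟩ := this
  obtain ⟨R', rfl⟩ := Multiset.exists_cons_of_mem he
  obtain ⟨p, q, hpq⟩ := hev e
  rw [hpq] at hex
  by_cases hp : p = x
  · exact ⟨e, R', q, rfl, by rw [hpq, hp]⟩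
  · have hq : q = x := by
      by_contra hq
      simp [hp, hq] at hex
    exact ⟨e, R', p, rfl, by rw [hpq, hq, add_comm]⟩

/-- Follow an alternating trail (edges of `T` and `R` in turn) that starts at `x` with an edge of
`T`.  Either it ends with an edge of `T` at a vertex `l` where `T` has the larger degree, or it ends
with an edge of `R` at a vertex `r` where `R` has the larger degree. -/
lemma exists_alternating_trail {ev : α → V →₀ ℕ}
    (hev : ∀ e, ∃ p q, ev e = Finsupp.single p 1 + Finsupp.single q 1)
    (T : Multiset α) : ∀ (R : Multiset α) (x : V), ∃ T₁ T₂ R₁ R₂, T = T₁ + T₂ ∧ R = R₁ + R₂ ∧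
      ((∃ l, edgeSum ev T₁ = Finsupp.single x 1 + edgeSum ev R₁ + Finsupp.single l 1 ∧
          Finsupp.single x 1 l + edgeSum ev R l < edgeSum ev T l ∧ T₁.card = R₁.card + 1) ∨
        (∃ r, Finsupp.single x 1 + edgeSum ev R₁ = Finsupp.single r 1 + edgeSum ev T₁ ∧
          edgeSum ev T r < Finsupp.single x 1 r + edgeSum ev R r ∧ T₁.card = R₁.card)) := by
  classical
  induction hn : T.card generalizing T with
  | zero =>
    intro R x
    rw [Multiset.card_eq_zero] at hn
    subst hn
    exact ⟨0, 0, 0, R, by simp, by simp, .inr ⟨x, by simp⟩⟩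
  | succ n ih =>
    intro R x
    by_cases hx : edgeSum ev T x = 0
    · exact ⟨0, T, 0, R, by simp, by simp, .inr ⟨x, by simp [hx]⟩⟩
    obtain ⟨f, T', y, rfl, hf⟩ := exists_edge_through hev hx
    by_cases hy : edgeSum ev R y = 0
    · refine ⟨{f}, T', 0, R, by simp, by simp, .inl ⟨y, ?_, ?_, by simp⟩⟩
      · simp [edgeSum, hf]
      · simp only [edgeSum_cons, hf, Finsupp.add_apply, hy, Finsupp.single_eq_same]
        omega
    obtain ⟨e, R', z, rfl, he⟩ := exists_edge_through hev hy
    obtain ⟨T₁, T₂, R₁, R₂, rfl, rfl, h⟩ := ih T' (by simpa using hn) R' z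
    refine ⟨f ::ₘ T₁, T₂, e ::ₘ R₁, R₂, by simp, by simp, ?_⟩
    rcases h with ⟨l, h1, h2, h3⟩ | ⟨r, h1, h2, h3⟩
    · refine .inl ⟨l, ?_, ?_, by simp [h3]⟩
      · simp only [edgeSum_cons, hf, he, h1]; abel
      · simp only [edgeSum_cons, hf, he, Finsupp.add_apply, edgeSum_add] at h2 ⊢; omega
    · refine .inr ⟨r, ?_, ?_, by simp [h3]⟩
      · simp only [edgeSum_cons, hf, he]
        rw [show Finsupp.single x 1 + (Finsupp.single y 1 + Finsupp.single z 1 + edgeSum ev R₁)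
          = Finsupp.single x 1 + Finsupp.single y 1 + (Finsupp.single z 1 + edgeSum ev R₁) by abel,
          h1]
        abel
      · simp only [edgeSum_cons, hf, he, Finsupp.add_apply, edgeSum_add] at h2 ⊢; omega

/-- If `T` has more edges than `R` and every edge of `T` has an end `≥ b`, then from some vertex `l`
where `T` has the larger degree there is an alternating trail that either arrives at a vertex
`y > b` with an edge of `R`, or arrives at `b` with an edge of `T`. -/
lemma exists_trail_of_card_lt [LinearOrder V] {ev : α → V →₀ ℕ}
    (hev : ∀ e, ∃ p q, ev e = Finsupp.single p 1 + Finsupp.single q 1) (b : V)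
    (R : Multiset α) : ∀ T : Multiset α, R.card < T.card →
      (∀ f ∈ T, ∀ p q, ev f = Finsupp.single p 1 + Finsupp.single q 1 → b ≤ p ∨ b ≤ q) →
      ∃ l T₁ T₂ R₁ R₂, T = T₁ + T₂ ∧ R = R₁ + R₂ ∧ edgeSum ev R l < edgeSum ev T l ∧
        ((∃ y, b < y ∧ edgeSum ev T₁ + Finsupp.single y 1 = Finsupp.single l 1 + edgeSum ev R₁ ∧
            T₁.card = R₁.card) ∨
          (edgeSum ev T₁ = Finsupp.single l 1 + Finsupp.single b 1 + edgeSum ev R₁ ∧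
            T₁.card = R₁.card + 1)) := by
  classical
  induction R using Multiset.strongInductionOn with
  | ih R ih =>
    intro T hcard hT
    have hdeg : ∀ e, (ev e).degree = 2 := by
      intro e
      obtain ⟨p, q, h⟩ := hev e
      simp [h, map_add]
    obtain ⟨l, hl⟩ : ∃ l, edgeSum ev R l < edgeSum ev T l := by
      by_contra! h
      have := Finsupp.degree_mono (show edgeSum ev T ≤ edgeSum ev R from h)
      rw [degree_edgeSum hdeg, degree_edgeSum hdeg] at this
      omega
    rcases lt_or_ge b l with hbl | hlb
    · exact ⟨l, 0, T, 0, R, by simp, by simp, hl, .inl ⟨l, hbl, by simp⟩⟩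
    obtain ⟨f, T', y, rfl, hf⟩ := exists_edge_through hev (R := T) (x := l) (by omega)
    by_cases hyb : y = b
    · exact ⟨l, {f}, T', 0, R, by simp, by simp, hl, .inr ⟨by simp [edgeSum, hf, hyb], by simp⟩⟩
    by_cases hy : edgeSum ev R y = 0
    · have hy' : edgeSum ev R y < edgeSum ev (f ::ₘ T') y := by
        simp only [edgeSum_cons, hf, Finsupp.add_apply, hy, Finsupp.single_eq_same]
        omega
      rcases lt_or_ge b y with hby | hyb'
      · exact ⟨y, 0, f ::ₘ T', 0, R, by simp, by simp, hy', .inl ⟨y, hby, by simp⟩⟩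
      · have hbl : l = b := by
          rcases hT f (by simp) l y hf with h | h
          · exact le_antisymm hlb h
          · exact absurd (le_antisymm hyb' h) hyb
        exact ⟨y, {f}, T', 0, R, by simp, by simp, hy',
          .inr ⟨by simp [edgeSum, hf, hbl, add_comm], by simp⟩⟩
    obtain ⟨e, R', p, rfl, he⟩ := exists_edge_through hev hy
    obtain ⟨l', T₁, T₂, R₁, R₂, rfl, rfl, h1, h2⟩ := ih R' (Multiset.lt_cons_self _ _) T'
      (by simpa using hcard) (fun g hg => hT g (by simp [hg]))
    by_cases hlp : l' = p
    · subst hlp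
      refine ⟨l, f ::ₘ T₁, T₂, e ::ₘ R₁, R₂, by simp, by simp, hl, ?_⟩
      rcases h2 with ⟨z, hz, h3, h4⟩ | ⟨h3, h4⟩
      · refine .inl ⟨z, hz, ?_, by simp [h4]⟩
        simp only [edgeSum_cons, hf, he]
        rw [add_assoc, h3]
        abel
      · refine .inr ⟨?_, by simp [h4]⟩
        simp only [edgeSum_cons, hf, he, h3]
        abel
    · refine ⟨l', T₁, f ::ₘ T₂, R₁, e ::ₘ R₂, by simp, by simp, ?_, h2⟩
      simp only [edgeSum_cons, hf, he, Finsupp.add_apply,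
        Finsupp.single_eq_of_ne hlp] at h1 ⊢
      omega

/-- Multiplicities of a multiset, compared at the smallest element where they differ. -/
def countLex [DecidableEq α] (R : Multiset α) : Lex (α → ℕ) := toLex fun e => R.count e

lemma countLex_injective [DecidableEq α] : Function.Injective (countLex (α := α)) := fun _ _ h =>
  Multiset.ext.2 fun e => congrFun (toLex.injective h) e

/-- Replacing `e` and some larger elements by elements `> e` decreases `countLex`. -/
lemma countLex_replace_lt [LinearOrder α] {e : α} {R T D : Multiset α} (hR : ∀ f ∈ R, e ≤ f)
    (hT : ∀ f ∈ T, e < f) : countLex (T + D) < countLex (e ::ₘ (R + D)) := by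
  have hT' : ∀ f ≤ e, T.count f = 0 := fun f hf =>
    Multiset.count_eq_zero.2 fun h => absurd (hT f h) (not_lt.2 hf)
  refine ⟨e, fun f hf => ?_, ?_⟩
  · have : R.count f = 0 := Multiset.count_eq_zero.2 fun h => absurd (hR f h) (not_le.2 hf)
    simp [countLex, hT' f hf.le, this, hf.ne]
  · simp [countLex, hT' e le_rfl]

/-- The exponent vector of the edge with ends given by a pair. -/
noncomputable def pairExp (e : V ×ₗ V) : V →₀ ℕ :=
  Finsupp.single (ofLex e).1 1 + Finsupp.single (ofLex e).2 1

/-- All members are edges of `E`, written with the larger end first. -/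
def IsEdgeMultiset [LE V] (E : V → V → Prop) (R : Multiset (V ×ₗ V)) : Prop :=
  ∀ e ∈ R, (ofLex e).2 ≤ (ofLex e).1 ∧ E (ofLex e).1 (ofLex e).2

/-- The edge with ends `p` and `q`, larger end first. -/
def mkEdge [LinearOrder V] (p q : V) : V ×ₗ V := toLex (max p q, min p q)

lemma pairExp_mkEdge [LinearOrder V] (p q : V) :
    pairExp (mkEdge p q) = Finsupp.single p 1 + Finsupp.single q 1 := by
  rcases le_total p q with h | h <;> simp [pairExp, mkEdge, h, add_comm]

lemma isEdge_mkEdge [LinearOrder V] {E : V → V → Prop} (hsymm : ∀ i j, E i j → E j i) {p q : V}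
    (h : E p q) : (ofLex (mkEdge p q)).2 ≤ (ofLex (mkEdge p q)).1 ∧
      E (ofLex (mkEdge p q)).1 (ofLex (mkEdge p q)).2 := by
  refine ⟨min_le_max, ?_⟩
  rcases le_total p q with h' | h' <;> simp [mkEdge, h', h, hsymm _ _ h]

lemma lt_mkEdge [LinearOrder V] {e : V ×ₗ V} {p : V} (q : V) (h : (ofLex e).1 < p) :
    e < mkEdge p q :=
  Prod.Lex.lt_iff.2 (.inl (h.trans_le (le_max_left _ _)))

lemma le_of_pairExp_eq [LinearOrder V] {e f : V ×ₗ V} (h : e < f) {p q : V}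
    (hf : pairExp f = Finsupp.single p 1 + Finsupp.single q 1) :
    (ofLex e).1 ≤ p ∨ (ofLex e).1 ≤ q := by
  have h1 : (ofLex e).1 ≤ (ofLex f).1 := by
    rcases Prod.Lex.lt_iff.1 h with h | h
    exacts [h.le, h.1.le]
  have h2 := DFunLike.congr_fun hf (ofLex f).1
  by_contra! h3
  have hp : (ofLex f).1 ≠ p := (h3.1.trans_le h1).ne'
  have hq : (ofLex f).1 ≠ q := (h3.2.trans_le h1).ne'
  simp [pairExp, hp, hq] at h2

lemma exists_exchange [LinearOrder V] {E : V → V → Prop} (hsymm : ∀ i j, E i j → E j i)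
    (hE : ∀ i j k, i < k → j < k → E i j → E i k ∨ E j k) {Ru Rv : Multiset (V ×ₗ V)}
    (hu : IsEdgeMultiset E Ru) (hv : IsEdgeMultiset E Rv) (hcard : Ru.card = Rv.card)
    (hmin : ∀ R, IsEdgeMultiset E R → R.card = Ru.card → edgeSum pairExp R = edgeSum pairExp Ru →
      ¬ countLex R < countLex Ru)
    (hlt : countLex Rv < countLex Ru) :
    ∃ R l r, IsEdgeMultiset E R ∧ R.card = Ru.card ∧ countLex R < countLex Ru ∧
      edgeSum pairExp R + Finsupp.single r 1 = edgeSum pairExp Ru + Finsupp.single l 1 ∧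
      edgeSum pairExp Ru l < edgeSum pairExp Rv l := by
  have hev : ∀ e : V ×ₗ V, ∃ p q, pairExp e = Finsupp.single p 1 + Finsupp.single q 1 :=
    fun e => ⟨_, _, rfl⟩
  obtain ⟨e, hbelow, he⟩ := hlt
  change Rv.count e < Ru.count e at he
  replace hbelow : ∀ f < e, Rv.count f = Ru.count f := hbelow
  have heu : e ∈ Ru - Rv := by
    rw [← Multiset.count_pos, Multiset.count_sub]; omega
  obtain ⟨R, hR⟩ := Multiset.exists_cons_of_mem heu
  obtain ⟨T, hT⟩ : ∃ T, T = Rv - Ru := ⟨_, rfl⟩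
  obtain ⟨C, hC⟩ : ∃ C, C = Ru ∩ Rv := ⟨_, rfl⟩
  have hRu : Ru = e ::ₘ (R + C) := by
    rw [← Multiset.cons_add, ← hR, hC, Multiset.sub_add_inter]
  have hRv : Rv = T + C := by
    rw [hT, hC, Multiset.inter_comm, Multiset.sub_add_inter]
  have hTgt : ∀ f ∈ T, e < f := by
    intro f hf
    rw [hT, ← Multiset.count_pos, Multiset.count_sub] at hf
    by_contra h
    rcases (not_lt.1 h).lt_or_eq with h | rfl
    · have := hbelow f h; omega
    · omega
  have hRge : ∀ f ∈ R, e ≤ f := by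
    intro f hf
    have hf' : f ∈ Ru - Rv := by rw [hR]; exact Multiset.mem_cons_of_mem hf
    rw [← Multiset.count_pos, Multiset.count_sub] at hf'
    by_contra h
    have := hbelow f (not_le.1 h)
    omega
  have hTE : ∀ f ∈ T, (ofLex f).2 ≤ (ofLex f).1 ∧ E (ofLex f).1 (ofLex f).2 :=
    fun f hf => hv f (by rw [hRv]; simp [hf])
  have hRE : ∀ f ∈ R + C, (ofLex f).2 ≤ (ofLex f).1 ∧ E (ofLex f).1 (ofLex f).2 :=
    fun f hf => hu f (by rw [hRu]; exact Multiset.mem_cons_of_mem hf)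
  have heE := hu e (by rw [hRu]; simp)
  have hcardTR : T.card = R.card + 1 := by
    rw [hRu, hRv] at hcard
    simp only [Multiset.card_cons, Multiset.card_add] at hcard
    omega
  -- replace `e` and `R₁` by the multiset `T₁` of larger edges
  have hreplace : ∀ (R₁ R₂ T₁ : Multiset (V ×ₗ V)) (l r : V), R = R₁ + R₂ →
      T₁.card = R₁.card + 1 → (∀ f ∈ T₁, e < f) →
      (∀ f ∈ T₁, (ofLex f).2 ≤ (ofLex f).1 ∧ E (ofLex f).1 (ofLex f).2) →
      edgeSum pairExp T₁ + Finsupp.single r 1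
        = pairExp e + edgeSum pairExp R₁ + Finsupp.single l 1 →
      ∃ R', IsEdgeMultiset E R' ∧ R'.card = Ru.card ∧ countLex R' < countLex Ru ∧
        edgeSum pairExp R' + Finsupp.single r 1 = edgeSum pairExp Ru + Finsupp.single l 1 := by
    intro R₁ R₂ T₁ l r hR₁ hc hgt hTE₁ hsum
    refine ⟨T₁ + (R₂ + C), ?_, ?_, ?_, ?_⟩
    · intro f hf
      rcases Multiset.mem_add.1 hf with hf | hf
      · exact hTE₁ f hf
      · refine hRE f ?_
        rw [hR₁, add_assoc]
        exact Multiset.mem_add.2 (.inr hf)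
    · rw [hRu, hR₁]
      simp only [Multiset.card_cons, Multiset.card_add]
      omega
    · rw [hRu, hR₁, add_assoc]
      exact countLex_replace_lt (fun f hf => hRge f (by rw [hR₁]; simp [hf])) hgt
    · rw [hRu, hR₁]
      simp only [edgeSum_add, edgeSum_cons]
      rw [show edgeSum pairExp T₁ + (edgeSum pairExp R₂ + edgeSum pairExp C) + Finsupp.single r 1
        = edgeSum pairExp T₁ + Finsupp.single r 1 + (edgeSum pairExp R₂ + edgeSum pairExp C)
        by abel, hsum]
      abel
  have hexc : ∀ l, edgeSum pairExp Ru l < edgeSum pairExp Rv l ↔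
      pairExp e l + edgeSum pairExp R l < edgeSum pairExp T l := by
    intro l
    rw [hRu, hRv]
    simp only [edgeSum_add, edgeSum_cons, Finsupp.add_apply]
    omega
  obtain ⟨a, ha⟩ : ∃ a, a = (ofLex e).2 := ⟨_, rfl⟩
  obtain ⟨b, hb⟩ : ∃ b, b = (ofLex e).1 := ⟨_, rfl⟩
  have hpe : pairExp e = Finsupp.single b 1 + Finsupp.single a 1 := by rw [ha, hb]; rfl
  rw [← ha, ← hb] at heE
  suffices ∃ R' l r, IsEdgeMultiset E R' ∧ R'.card = Ru.card ∧ countLex R' < countLex Ru ∧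
      edgeSum pairExp R' + Finsupp.single r 1 = edgeSum pairExp Ru + Finsupp.single l 1 ∧
      pairExp e l + edgeSum pairExp R l < edgeSum pairExp T l by
    obtain ⟨R', l, r, h1, h2, h3, h4, h5⟩ := this
    exact ⟨R', l, r, h1, h2, h3, h4, (hexc l).2 h5⟩
  -- the trail that leaves `e` at `b`
  obtain ⟨T₁, T₂, R₁, R₂, hT₁, hR₁, ⟨l, h1, h2, h3⟩ | ⟨r, h1, h2, h3⟩⟩ :=
    exists_alternating_trail hev T R b
  · have hsum : edgeSum pairExp T₁ + Finsupp.single a 1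
        = pairExp e + edgeSum pairExp R₁ + Finsupp.single l 1 := by rw [h1, hpe]; abel
    obtain ⟨R', h4, h5, h6, h7⟩ := hreplace R₁ R₂ T₁ l a hR₁ h3
      (fun f hf => hTgt f (by rw [hT₁]; simp [hf]))
      (fun f hf => hTE f (by rw [hT₁]; simp [hf])) hsum
    by_cases hla : l = a
    · subst hla
      exact absurd h6 (hmin R' h4 h5 (add_right_cancel h7))
    · refine ⟨R', l, a, h4, h5, h6, h7, ?_⟩
      rw [hpe, Finsupp.add_apply, Finsupp.single_eq_of_ne hla]
      omega
  -- the trail that leaves `e` at `a`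
  obtain ⟨T₃, T₄, R₃, R₄, hT₃, hR₃, ⟨l, h4, h5, h6⟩ | ⟨s, h4, h5, h6⟩⟩ :=
    exists_alternating_trail hev T₂ R₂ a
  · have hsum : edgeSum pairExp T₃ + Finsupp.single b 1
        = pairExp e + edgeSum pairExp R₃ + Finsupp.single l 1 := by rw [h4, hpe]; abel
    obtain ⟨R', h7, h8, h9, h10⟩ := hreplace R₃ (R₁ + R₄) T₃ l b
      (by rw [hR₁, hR₃]; abel) h6
      (fun f hf => hTgt f (by rw [hT₁, hT₃]; simp [hf]))
      (fun f hf => hTE f (by rw [hT₁, hT₃]; simp [hf])) hsum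
    refine ⟨R', l, b, h7, h8, h9, h10, ?_⟩
    have h11 := DFunLike.congr_fun h1 l
    rw [hT₁, hR₁] at h2 ⊢
    simp only [hpe, edgeSum_add, Finsupp.add_apply] at h2 h5 h11 ⊢
    by_cases hlr : l = r
    · subst hlr
      rw [Finsupp.single_eq_same] at h11
      omega
    · rw [Finsupp.single_eq_of_ne hlr] at h11
      omega
  -- both trails end where `R` has the larger degree
  obtain ⟨l, T₅, T₆, R₅, R₆, hT₅, hR₅, h7, h8⟩ := exists_trail_of_card_lt hev b R₄ T₄
    (by
      have := congrArg Multiset.card hT₁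
      have := congrArg Multiset.card hR₁
      have := congrArg Multiset.card hT₃
      have := congrArg Multiset.card hR₃
      simp only [Multiset.card_add] at *
      omega)
    (fun f hf p q hpq => by
      rw [hb]; exact le_of_pairExp_eq (hTgt f (by rw [hT₁, hT₃]; simp [hf])) hpq)
  have hl : pairExp e l + edgeSum pairExp R l < edgeSum pairExp T l := by
    have e1 := DFunLike.congr_fun h1 l
    have e4 := DFunLike.congr_fun h4 l
    rw [hT₁, hR₁, hT₃, hR₃] at h2 ⊢
    rw [hT₃, hR₃] at h5
    simp only [hpe, edgeSum_add, Finsupp.add_apply] at h2 h5 e1 e4 ⊢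
    by_cases hls : l = s
    · subst hls
      rw [Finsupp.single_eq_same] at e4
      by_cases hlr : l = r
      · subst hlr
        rw [Finsupp.single_eq_same] at e1
        omega
      · rw [Finsupp.single_eq_of_ne hlr] at e1
        omega
    rw [Finsupp.single_eq_of_ne hls] at e4
    by_cases hlr : l = r
    · subst hlr
      rw [Finsupp.single_eq_same] at e1
      omega
    · rw [Finsupp.single_eq_of_ne hlr] at e1
      omega
  have hRdec : R = R₅ + (R₁ + R₃ + R₆) := by rw [hR₁, hR₃, hR₅]; abel
  have hT₅T : ∀ f ∈ T₅, f ∈ T := fun f hf => by rw [hT₁, hT₃, hT₅]; simp [hf]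
  rcases h8 with ⟨y, hby, h8, h9⟩ | ⟨h8, h9⟩
  · -- join `y` to an end of `e`
    have hjoin : ∀ c d, E y c → pairExp e = Finsupp.single c 1 + Finsupp.single d 1 →
        ∃ R', IsEdgeMultiset E R' ∧ R'.card = Ru.card ∧ countLex R' < countLex Ru ∧
          edgeSum pairExp R' + Finsupp.single d 1
            = edgeSum pairExp Ru + Finsupp.single l 1 := by
      intro c d hyc hcd
      refine hreplace R₅ _ (mkEdge y c ::ₘ T₅) l d hRdec (by simp [h9]) ?_ ?_ ?_
      · intro f hf
        rcases Multiset.mem_cons.1 hf with rfl | hf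
        · exact lt_mkEdge _ (hb ▸ hby)
        · exact hTgt f (hT₅T f hf)
      · intro f hf
        rcases Multiset.mem_cons.1 hf with rfl | hf
        · exact isEdge_mkEdge hsymm hyc
        · exact hTE f (hT₅T f hf)
      · rw [edgeSum_cons, pairExp_mkEdge, hcd]
        calc _ = (edgeSum pairExp T₅ + Finsupp.single y 1) +
              (Finsupp.single c 1 + Finsupp.single d 1) := by abel
          _ = _ := by rw [h8]; abel
    rcases hE b a y hby (heE.1.trans_lt hby) heE.2 with h | h
    · obtain ⟨R', h⟩ := hjoin b a (hsymm _ _ h) hpe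
      exact ⟨R', l, a, h.1, h.2.1, h.2.2.1, h.2.2.2, hl⟩
    · obtain ⟨R', h⟩ := hjoin a b (hsymm _ _ h) (by rw [hpe, add_comm])
      exact ⟨R', l, b, h.1, h.2.1, h.2.2.1, h.2.2.2, hl⟩
  · obtain ⟨R', h⟩ := hreplace R₅ _ T₅ l a hRdec h9 (fun f hf => hTgt f (hT₅T f hf))
      (fun f hf => hTE f (hT₅T f hf)) (by rw [h8, hpe]; abel)
    exact ⟨R', l, a, h.1, h.2.1, h.2.2.1, h.2.2.2, hl⟩

/-- The exponent vectors of products of `k` edges of `E`. -/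
def edgeProducts (E : V → V → Prop) (k : ℕ) : Set (V →₀ ℕ) :=
  {a | ∃ s : Multiset (V × V), s.card = k ∧ (∀ p ∈ s, E p.1 p.2) ∧
    a = edgeSum (fun p => Finsupp.single p.1 1 + Finsupp.single p.2 1) s}

lemma mem_edgeProducts_iff [LinearOrder V] {E : V → V → Prop} (hsymm : ∀ i j, E i j → E j i)
    {k : ℕ} {a : V →₀ ℕ} : a ∈ edgeProducts E k ↔
      ∃ R : Multiset (V ×ₗ V), IsEdgeMultiset E R ∧ R.card = k ∧ edgeSum pairExp R = a := by
  constructor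
  · rintro ⟨s, hs, hsE, rfl⟩
    refine ⟨s.map fun p => mkEdge p.1 p.2, ?_, by simpa using hs, ?_⟩
    · intro e he
      obtain ⟨p, hp, rfl⟩ := Multiset.mem_map.1 he
      exact isEdge_mkEdge hsymm (hsE p hp)
    · simp only [edgeSum, Multiset.map_map, Function.comp_def, pairExp_mkEdge]
  · rintro ⟨R, hR, hk, rfl⟩
    refine ⟨R.map ofLex, by simpa using hk, ?_, ?_⟩
    · intro p hp
      obtain ⟨e, he, rfl⟩ := Multiset.mem_map.1 hp
      exact (hR e he).2
    · simp only [edgeSum, Multiset.map_map, Function.comp_def]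
      rfl

/-- The products of `k` edges can be ordered as required for linear quotients. -/
theorem exists_ordering_edgeProducts [LinearOrder V] [Finite V] {E : V → V → Prop}
    (hsymm : ∀ i j, E i j → E j i) (hE : ∀ i j k, i < k → j < k → E i j → E i k ∨ E j k) (k : ℕ) :
    ∃ (m : ℕ) (u : Fin m → V →₀ ℕ), Function.Injective u ∧ Set.range u = edgeProducts E k ∧
      ∀ i j, j < i → ∃ j' < i, ∃ l r, u i l < u j l ∧
        u j' + Finsupp.single r 1 = u i + Finsupp.single l 1 := by
  classical
  have := Fintype.ofFinite V
  have := Fintype.ofFinite (V ×ₗ V)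
  let Rep (R : Multiset (V ×ₗ V)) : Prop := IsEdgeMultiset E R ∧ R.card = k
  let Min (R : Multiset (V ×ₗ V)) : Prop := Rep R ∧
    ∀ R', Rep R' → edgeSum pairExp R' = edgeSum pairExp R → countLex R ≤ countLex R'
  have hfin : {R : Multiset (V ×ₗ V) | R.card = k}.Finite :=
    (Set.finite_range fun s : Sym (V ×ₗ V) k => (s : Multiset (V ×ₗ V))).subset
      fun R hR => ⟨⟨R, hR⟩, rfl⟩
  have hfinRep : {R | Rep R}.Finite := hfin.subset fun R hR => hR.2
  have hfinMin : {R | Min R}.Finite := hfinRep.subset fun R hR => hR.1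
  have hexMin : ∀ R, Rep R → ∃ R', Min R' ∧ edgeSum pairExp R' = edgeSum pairExp R ∧
      countLex R' ≤ countLex R := by
    intro R hR
    obtain ⟨R', ⟨h1, h2⟩, h3⟩ := Set.exists_min_image
      {R' | Rep R' ∧ edgeSum pairExp R' = edgeSum pairExp R} countLex
      (hfinRep.subset fun _ h => h.1) ⟨R, hR, rfl⟩
    exact ⟨R', ⟨h1, fun R'' h4 h5 => h3 R'' ⟨h4, h5.trans h2⟩⟩, h2, h3 R ⟨hR, rfl⟩⟩
  let s := hfinMin.toFinset.image countLex
  let ord := s.orderEmbOfFin rfl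
  have hord : ∀ i, ∃ R, Min R ∧ countLex R = ord i := by
    intro i
    obtain ⟨R, hR, h⟩ := Finset.mem_image.1 (s.orderEmbOfFin_mem rfl i)
    exact ⟨R, by simpa using hR, h⟩
  have hidx : ∀ R, Min R → ∃ i, ord i = countLex R := by
    intro R hR
    have : countLex R ∈ Set.range ord := by
      rw [Finset.range_orderEmbOfFin]
      exact Finset.mem_coe.2 (Finset.mem_image_of_mem _ (by simpa using hR))
    exact this
  choose rep hrep hrepord using hord
  have hidx' : ∀ R, Min R → ∃ i, rep i = R := fun R hR => by
    obtain ⟨i, hi⟩ := hidx R hR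
    exact ⟨i, countLex_injective ((hrepord i).trans hi)⟩
  have hlt : ∀ i j, countLex (rep i) < countLex (rep j) ↔ i < j := fun i j => by
    rw [hrepord, hrepord]
    exact ord.lt_iff_lt
  refine ⟨s.card, fun i => edgeSum pairExp (rep i), ?_, ?_, ?_⟩
  · intro i j hij
    refine le_antisymm ?_ ?_ <;> refine not_lt.1 fun h => ?_
    · exact absurd ((hlt _ _).2 h) (not_lt.2 ((hrep i).2 _ (hrep j).1 hij.symm))
    · exact absurd ((hlt _ _).2 h) (not_lt.2 ((hrep j).2 _ (hrep i).1 hij))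
  · ext a
    rw [mem_edgeProducts_iff hsymm]
    constructor
    · rintro ⟨i, rfl⟩
      exact ⟨rep i, (hrep i).1.1, (hrep i).1.2, rfl⟩
    · rintro ⟨R, hR, hk, rfl⟩
      obtain ⟨R', h1, h2, -⟩ := hexMin R ⟨hR, hk⟩
      obtain ⟨i, rfl⟩ := hidx' R' h1
      exact ⟨i, h2⟩
  · intro i j hji
    obtain ⟨R, l, r, h1, h2, h3, h4, h5⟩ := exists_exchange hsymm hE (hrep i).1.1 (hrep j).1.1
      ((hrep i).1.2.trans (hrep j).1.2.symm)
      (fun R h h' h'' => not_lt.2 ((hrep i).2 R ⟨h, h'.trans (hrep i).1.2⟩ h'')) ((hlt _ _).2 hji)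
    obtain ⟨R', h6, h7, h8⟩ := hexMin R ⟨h1, h2.trans (hrep i).1.2⟩
    obtain ⟨j', rfl⟩ := hidx' R' h6
    exact ⟨j', (hlt _ _).1 (h8.trans_lt h3), l, r, h5, by simpa only [h7] using h4⟩

end EdgeProducts

section Elimination

variable {V : Type*} [DecidableEq V]

/-- The neighbours of `w` in `X` are pairwise adjacent. -/
def IsSimplicialIn (N : V → V → Prop) (X : Finset V) (w : V) : Prop :=
  w ∈ X ∧ ∀ p ∈ X, ∀ q ∈ X, N w p → N w q → p ≠ q → N p q

/-- Connectivity obstruction to a pair `s`, `t` of non-adjacent vertices in a minimal separator. -/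
def HasSeparatingFunctions (K : Type*) (N : V → V → Prop) : Prop :=
  ∀ (B : Finset V) (v s t : V), v ∉ B → s ∉ B → t ∉ B → s ≠ t → s ≠ v → t ≠ v → ¬ N s t →
    (∀ b ∈ B, ¬ N v b) → N s v → ∃ g : V → K, g s ≠ g v ∧
      ∀ p ∈ insert s (insert t (insert v B)), ∀ q ∈ insert s (insert t (insert v B)), N p q →
        ¬ (p = s ∧ q = v) → ¬ (p = v ∧ q = s) → g p = g q

lemma exists_simplicial_of_forall {N : V → V → Prop} (hsymm : ∀ p q, N p q → N q p) {X : Finset V}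
    (hX : X.Nonempty)
    (h : ∀ v ∈ X, (∃ y ∈ X, y ≠ v ∧ ¬ N v y) → ∃ w, IsSimplicialIn N X w ∧ w ≠ v ∧ ¬ N v w) :
    ∃ w, IsSimplicialIn N X w := by
  by_cases hv : ∃ v ∈ X, ∃ y ∈ X, y ≠ v ∧ ¬ N v y
  · obtain ⟨v, hv, hy⟩ := hv
    obtain ⟨w, hw, -⟩ := h v hv hy
    exact ⟨w, hw⟩
  · push Not at hv
    obtain ⟨w, hw⟩ := hX
    exact ⟨w, hw, fun p hp q hq _ _ hpq => hsymm _ _ (hv q hq p hp hpq)⟩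

theorem exists_simplicial_not_adj {K : Type*} {N : V → V → Prop} (hsymm : ∀ p q, N p q → N q p)
    (hsep : HasSeparatingFunctions K N) (X : Finset V) :
    ∀ v ∈ X, (∃ y ∈ X, y ≠ v ∧ ¬ N v y) → ∃ w, IsSimplicialIn N X w ∧ w ≠ v ∧ ¬ N v w := by
  classical
  induction X using Finset.strongInduction with
  | H X ih =>
  rintro v hvX ⟨y₀, hy₀X, hy₀v, hvy₀⟩
  obtain ⟨Y, hY⟩ : ∃ Y, Y = X.filter fun y => y ≠ v ∧ ¬ N v y := ⟨_, rfl⟩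
  have memY : ∀ y, y ∈ Y ↔ y ∈ X ∧ y ≠ v ∧ ¬ N v y := fun y => by rw [hY, Finset.mem_filter]
  obtain ⟨B, hB⟩ : ∃ B, B = Y.filter fun y =>
    Relation.ReflTransGen (fun a b => b ∈ Y ∧ N a b) y₀ y := ⟨_, rfl⟩
  have memB : ∀ y, y ∈ B ↔ y ∈ Y ∧ Relation.ReflTransGen (fun a b => b ∈ Y ∧ N a b) y₀ y :=
    fun y => by rw [hB, Finset.mem_filter]
  have hy₀ : y₀ ∈ B := (memB _).2 ⟨(memY _).2 ⟨hy₀X, hy₀v, hvy₀⟩, .refl⟩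
  have hclosed : ∀ b ∈ B, ∀ c ∈ Y, N b c → c ∈ B := fun b hb c hc h =>
    (memB c).2 ⟨hc, ((memB b).1 hb).2.tail ⟨hc, h⟩⟩
  have hBX : ∀ b ∈ B, b ∈ X ∧ b ≠ v ∧ ¬ N v b := fun b hb => (memY b).1 ((memB b).1 hb).1
  have hvB : v ∉ B := fun h => (hBX v h).2.1 rfl
  obtain ⟨S, hS⟩ : ∃ S, S = X.filter fun s => s ∉ B ∧ ∃ b ∈ B, N s b := ⟨_, rfl⟩
  have memS : ∀ s, s ∈ S ↔ s ∈ X ∧ s ∉ B ∧ ∃ b ∈ B, N s b := fun s => by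
    rw [hS, Finset.mem_filter]
  have hvS : v ∉ S := fun h => by
    obtain ⟨-, -, b, hb, h⟩ := (memS v).1 h
    exact (hBX b hb).2.2 h
  have hSv : ∀ s ∈ S, N v s := fun s hs => by
    obtain ⟨hsX, hsB, b, hb, h⟩ := (memS s).1 hs
    by_contra hvs
    exact hsB (hclosed b hb s ((memY s).2 ⟨hsX, fun h => hvS (h ▸ hs), hvs⟩) (hsymm _ _ h))
  have hclique : ∀ s ∈ S, ∀ t ∈ S, s ≠ t → N s t := by
    intro s hs t ht hst
    by_contra hN
    obtain ⟨-, hsB, b, hb, hsb⟩ := (memS s).1 hs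
    obtain ⟨-, htB, c, hc, htc⟩ := (memS t).1 ht
    have hsv : s ≠ v := fun h => hvS (h ▸ hs)
    have htv : t ≠ v := fun h => hvS (h ▸ ht)
    obtain ⟨g, hg, hgN⟩ := hsep B v s t hvB hsB htB hst hsv htv hN
      (fun b hb => (hBX b hb).2.2) (hsymm _ _ (hSv s hs))
    have hconst : ∀ y, Relation.ReflTransGen (fun a b => b ∈ Y ∧ N a b) y₀ y →
        y ∈ B ∧ g y = g y₀ := by
      intro y hy
      induction hy with
      | refl => exact ⟨hy₀, rfl⟩
      | @tail p q _ hpq ihp =>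
        have hqB := hclosed p ihp.1 q hpq.1 hpq.2
        refine ⟨hqB, (hgN q (by simp [hqB]) p (by simp [ihp.1]) (hsymm _ _ hpq.2) ?_ ?_).trans
          ihp.2⟩
        · rintro ⟨rfl, -⟩; exact hsB hqB
        · rintro ⟨rfl, -⟩; exact hvB hqB
    have h1 : g s = g b := hgN s (by simp) b (by simp [hb]) hsb
      (fun h => hvB (h.2 ▸ hb)) (fun h => hsv h.1)
    have h2 : g t = g c := hgN t (by simp) c (by simp [hc]) htc
      (fun h => hst h.1.symm) (fun h => htv h.1)
    have h3 : g t = g v := hgN t (by simp) v (by simp) (hsymm _ _ (hSv t ht))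
      (fun h => hst h.1.symm) (fun h => htv h.1)
    refine hg ?_
    rw [h1, (hconst b ((memB b).1 hb).2).2, ← h3, h2, (hconst c ((memB c).1 hc).2).2]
  have hnbr : ∀ w ∈ B, ∀ p ∈ X, N w p → p ∈ B ∪ S := fun w hw p hp h => by
    by_cases hpB : p ∈ B
    · simp [hpB]
    · exact Finset.mem_union_right _ ((memS p).2 ⟨hp, hpB, w, hw, hsymm _ _ h⟩)
  suffices ∃ w ∈ B, IsSimplicialIn N (B ∪ S) w by
    obtain ⟨w, hwB, -, hw⟩ := this
    exact ⟨w, ⟨(hBX w hwB).1, fun p hp q hq h h' =>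
      hw p (hnbr w hwB p hp h) q (hnbr w hwB q hq h') h h'⟩, (hBX w hwB).2⟩
  by_cases hs : ∃ s ∈ S, ∃ y ∈ B ∪ S, y ≠ s ∧ ¬ N s y
  · obtain ⟨s, hs, hy⟩ := hs
    have hlt : B ∪ S ⊂ X := by
      refine (Finset.ssubset_iff_of_subset ?_).2 ⟨v, hvX, by simp [hvB, hvS]⟩
      refine Finset.union_subset (fun b hb => (hBX b hb).1) fun s hs => ((memS s).1 hs).1
    obtain ⟨w, hw, hws, hsw⟩ := ih _ hlt s (by simp [hs]) hy
    refine ⟨w, ?_, hw⟩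
    rcases Finset.mem_union.1 hw.1 with h | h
    · exact h
    · exact absurd (hclique s hs w h hws.symm) hsw
  · push Not at hs
    have hlt : B ⊂ X := (Finset.ssubset_iff_of_subset fun b hb => (hBX b hb).1).2 ⟨v, hvX, hvB⟩
    obtain ⟨w, hw⟩ := exists_simplicial_of_forall hsymm ⟨y₀, hy₀⟩ (ih B hlt)
    refine ⟨w, hw.1, Finset.mem_union_left _ hw.1, fun p hp q hq h h' hpq => ?_⟩
    rcases Finset.mem_union.1 hp with hp' | hp'
    · rcases Finset.mem_union.1 hq with hq' | hq'
      · exact hw.2 p hp' q hq' h h' hpq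
      · exact hsymm _ _ (hs q hq' p hp hpq)
    · exact hs p hp' q hq hpq.symm

/-- If every nonempty set of vertices contains a vertex that dominates an end of each remaining
edge, then the vertices can be ranked accordingly. -/
lemma exists_elimination_rank_on {E : V → V → Prop}
    (h : ∀ X : Finset V, X.Nonempty →
      ∃ k ∈ X, ∀ i ∈ X, ∀ j ∈ X, i ≠ k → j ≠ k → E i j → E i k ∨ E j k)
    (X : Finset V) : ∃ ρ : V → ℕ, Set.InjOn ρ X ∧ (∀ x ∈ X, ρ x < X.card) ∧
      ∀ i ∈ X, ∀ j ∈ X, ∀ k ∈ X, ρ i < ρ k → ρ j < ρ k → E i j → E i k ∨ E j k := by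
  induction X using Finset.strongInduction with
  | H X ih =>
  rcases X.eq_empty_or_nonempty with rfl | hX
  · exact ⟨fun _ => 0, by simp, by simp, by simp⟩
  obtain ⟨k, hk, hkE⟩ := h X hX
  obtain ⟨ρ, h1, h2, h3⟩ := ih _ (Finset.erase_ssubset hk)
  have hcard : (X.erase k).card + 1 = X.card := Finset.card_erase_add_one hk
  have hlt : ∀ x ∈ X, x ≠ k → ρ x < (X.erase k).card := fun x hx hxk =>
    h2 x (Finset.mem_erase.2 ⟨hxk, hx⟩)
  refine ⟨Function.update ρ k (X.erase k).card, ?_, ?_, ?_⟩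
  · intro x hx y hy hxy
    by_cases hxk : x = k <;> by_cases hyk : y = k
    · rw [hxk, hyk]
    · have := hlt y hy hyk
      simp [hxk, hyk] at hxy; omega
    · have := hlt x hx hxk
      simp [hxk, hyk] at hxy; omega
    · simp only [ne_eq, hxk, not_false_eq_true, Function.update_of_ne, hyk] at hxy
      exact h1 (by simpa [hxk] using hx) (by simpa [hyk] using hy) hxy
  · intro x hx
    by_cases hxk : x = k
    · simp [hxk]; omega
    · have := hlt x hx hxk
      simp [hxk]; omega
  · intro i hi j hj l hl hil hjl hij
    by_cases hlk : l = k
    · subst hlk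
      exact hkE i hi j hj (fun h => by simp [h] at hil) (fun h => by simp [h] at hjl) hij
    · have hl' := hlt l hl hlk
      have hik : i ≠ k := fun h => by simp [h, hlk] at hil; omega
      have hjk : j ≠ k := fun h => by simp [h, hlk] at hjl; omega
      simp only [ne_eq, hik, not_false_eq_true, Function.update_of_ne, hlk, hjk] at hil hjl
      exact h3 i (by simp [*]) j (by simp [*]) l (by simp [*]) hil hjl hij

/-- The elimination order used for the products of edges. -/
theorem exists_elimination_rank [Finite V] {K : Type*} {E : V → V → Prop}
    (hsymm : ∀ i j, E i j → E j i) (hloop : ∀ i j k, E k k → E i j → E i k ∨ E j k)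
    (hsep : HasSeparatingFunctions K fun p q => p ≠ q ∧ ¬ E p q) :
    ∃ ρ : V → ℕ, Function.Injective ρ ∧
      ∀ i j k, ρ i < ρ k → ρ j < ρ k → E i j → E i k ∨ E j k := by
  have := Fintype.ofFinite V
  obtain ⟨ρ, h1, -, h3⟩ := exists_elimination_rank_on (E := E) (fun X hX => by
    by_cases hl : ∃ k ∈ X, E k k
    · obtain ⟨k, hk, hkk⟩ := hl
      exact ⟨k, hk, fun i _ j _ _ _ => hloop i j k hkk⟩
    push Not at hl
    have hsymm' : ∀ p q, p ≠ q ∧ ¬ E p q → q ≠ p ∧ ¬ E q p := fun p q h =>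
      ⟨h.1.symm, fun h' => h.2 (hsymm _ _ h')⟩
    obtain ⟨k, hk, hkS⟩ := exists_simplicial_of_forall hsymm' hX
      (exists_simplicial_not_adj hsymm' hsep X)
    refine ⟨k, hk, fun i hi j hj hik hjk hij => ?_⟩
    by_contra! hc
    refine (hkS i hi j hj ⟨hik.symm, fun h => hc.1 (hsymm _ _ h)⟩
      ⟨hjk.symm, fun h => hc.2 (hsymm _ _ h)⟩ ?_).2 hij
    rintro rfl
    exact hl i hi hij) Finset.univ
  refine ⟨ρ, fun x y h => h1 (by simp) (by simp) h, fun i j k => ?_⟩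
  exact h3 i (by simp) j (by simp) k (by simp)

end Elimination

section Koszul

variable {σ τ : Type*} [LinearOrder σ] {K : Type*} [CommRing K]

lemma divMonomial_X_mul_of_ne {p j : τ} (hpj : p ≠ j) (f : MvPolynomial τ K) :
    (X p * f).divMonomial (Finsupp.single j 1) = X p * f.divMonomial (Finsupp.single j 1) := by
  classical
  ext m
  rw [coeff_divMonomial, coeff_X_mul', coeff_X_mul', coeff_divMonomial]
  by_cases hp : p ∈ m.support
  · have hp' : 1 ≤ m p := Nat.one_le_iff_ne_zero.2 (Finsupp.mem_support_iff.1 hp)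
    have hs : p ∈ (Finsupp.single j 1 + m).support := by
      rw [Finsupp.mem_support_iff, Finsupp.add_apply]; omega
    rw [if_pos hp, if_pos hs, add_tsub_assoc_of_le]
    exact Finsupp.single_le_iff.2 hp'
  · rw [if_neg hp, if_neg]
    rw [Finsupp.notMem_support_iff] at hp ⊢
    rw [Finsupp.add_apply, hp, Finsupp.single_eq_of_ne hpj, add_zero]

lemma divMonomial_smul (a : K) (f : MvPolynomial τ K) (s : τ →₀ ℕ) :
    (a • f).divMonomial s = a • f.divMonomial s := by
  ext m; simp [coeff_divMonomial]

lemma divMonomial_sum {ι : Type*} (t : Finset ι) (f : ι → MvPolynomial τ K) (s : τ →₀ ℕ) :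
    (∑ i ∈ t, f i).divMonomial s = ∑ i ∈ t, (f i).divMonomial s := by
  ext m; simp [coeff_divMonomial, coeff_sum]

lemma homogeneousComponent_mul_of_isHomogeneous {R : Type*} [CommSemiring R] {d : ℕ}
    (c : MvPolynomial τ R) {h : MvPolynomial τ R} (hh : h.IsHomogeneous d) (e : ℕ) :
    homogeneousComponent (e + d) (c * h) = homogeneousComponent e c * h := by
  let _ : GradedRing (homogeneousSubmodule τ R) := MvPolynomial.gradedAlgebra
  have key := DirectSum.coe_decompose_mul_add_of_right_mem (homogeneousSubmodule τ R) (i := e)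
    (a := c) hh
  rw [← decomposition.decompose'_apply, ← decomposition.decompose'_apply]
  exact key

variable (K) in
/-- The sign of inserting `j` into `T`. -/
def insertSign (j : σ) (T : Finset σ) : K := (-1) ^ (T.filter (· < j)).card

lemma insertSign_mul_self (j : σ) (T : Finset σ) : insertSign K j T * insertSign K j T = 1 := by
  rw [insertSign, ← mul_pow]; simp

lemma insertSign_insert {j p : σ} {T : Finset σ} (hp : p ∉ T) :
    insertSign K j (insert p T) = (if p < j then -1 else 1) * insertSign K j T := by
  unfold insertSign
  rw [Finset.filter_insert]
  split_ifs with h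
  · rw [Finset.card_insert_of_notMem (by simp [hp]), pow_succ, mul_comm]
  · rw [one_mul]

lemma insertSign_swap {p q : σ} {T : Finset σ} (hpq : p ≠ q) (hp : p ∉ T) (hq : q ∉ T) :
    insertSign K q (insert p T) * insertSign K p T
      = -(insertSign K p (insert q T) * insertSign K q T) := by
  rw [insertSign_insert hp, insertSign_insert hq]
  rcases lt_or_gt_of_ne hpq with h | h
  · rw [if_pos h, if_neg h.not_gt]; ring
  · rw [if_pos h, if_neg h.not_gt]; ring

/-- Contraction of a Koszul chain by the basis vector `j`. -/
noncomputable def contract (j : σ) (z : Finset σ → MvPolynomial σ K) :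
    Finset σ → MvPolynomial σ K :=
  fun T => if j ∈ T then 0 else insertSign K j T • z (insert j T)

/-- Multiplication of a Koszul chain by the basis vector `j`. -/
noncomputable def wedge (j : σ) (z : Finset σ → MvPolynomial σ K) :
    Finset σ → MvPolynomial σ K :=
  fun T => if j ∈ T then insertSign K j (T.erase j) • z (T.erase j) else 0

lemma contract_contract (p q : σ) (z : Finset σ → MvPolynomial σ K) (T : Finset σ) :
    contract p (contract q z) T + contract q (contract p z) T = 0 := by
  unfold contract
  by_cases hp : p ∈ T
  · simp [hp]
  by_cases hq : q ∈ T
  · simp [hq]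
  by_cases hpq : p = q
  · simp [hpq]
  simp only [hp, hq, hpq, Ne.symm hpq, Finset.mem_insert, or_self, if_false, smul_smul]
  rw [mul_comm, insertSign_swap hpq hp hq, mul_comm (insertSign K q T), Finset.insert_comm q p,
    ← add_smul, neg_add_cancel, zero_smul]

lemma contract_self (p : σ) (z : Finset σ → MvPolynomial σ K) (T : Finset σ) :
    contract p (contract p z) T = 0 := by
  simp [contract]

lemma contract_wedge_self (j : σ) (z : Finset σ → MvPolynomial σ K) (T : Finset σ) :
    contract j (wedge j z) T = if j ∈ T then 0 else z T := by
  by_cases hj : j ∈ T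
  · simp [contract, hj]
  · simp [contract, wedge, hj, smul_smul, insertSign_mul_self]

lemma wedge_contract_self (j : σ) (z : Finset σ → MvPolynomial σ K) (T : Finset σ) :
    wedge j (contract j z) T = if j ∈ T then z T else 0 := by
  by_cases hj : j ∈ T
  · simp [contract, wedge, hj, smul_smul, insertSign_mul_self]
  · simp [wedge, hj]

lemma contract_wedge {p j : σ} (hpj : p ≠ j) (z : Finset σ → MvPolynomial σ K) (T : Finset σ) :
    contract p (wedge j z) T + wedge j (contract p z) T = 0 := by
  unfold contract wedge
  by_cases hj : j ∈ T
  swap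
  · simp [hj, hpj.symm]
  obtain ⟨U, hU, rfl⟩ : ∃ U, j ∉ U ∧ insert j U = T :=
    ⟨T.erase j, by simp, Finset.insert_erase hj⟩
  by_cases hp : p ∈ U
  · simp [hp, hpj]
  have h1 : (insert p (insert j U)).erase j = insert p U := by
    rw [Finset.insert_comm, Finset.erase_insert (by simp [hU, hpj.symm])]
  simp only [hp, hpj, Finset.mem_insert, or_self, if_false, or_true, true_or, if_true, h1,
    Finset.erase_insert hU, smul_smul, ← add_smul]
  have h2 := insertSign_swap (K := K) hpj hp hU
  have h3 : insertSign K p (insert j U) * insertSign K j (insert p U)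
      + insertSign K j U * insertSign K p U = 0 := by
    linear_combination (insertSign K p U * insertSign K p (insert j U)) * h2 -
      insertSign K p (insert j U) * insertSign K j (insert p U) *
        insertSign_mul_self (K := K) p U -
      insertSign K j U * insertSign K p U * insertSign_mul_self (K := K) p (insert j U)
  rw [h3, zero_smul]

lemma contract_sum {ι : Type*} (s : Finset ι) (p : σ) (a : ι → MvPolynomial σ K)
    (z : ι → Finset σ → MvPolynomial σ K) (T : Finset σ) :
    contract p (fun U => ∑ i ∈ s, a i * z i U) T = ∑ i ∈ s, a i * contract p (z i) T := by
  by_cases h : p ∈ T <;> simp [contract, h, Finset.smul_sum]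

/-- Division of all coefficients by a variable. -/
noncomputable def divX (j : σ) (z : Finset σ → MvPolynomial σ K) : Finset σ → MvPolynomial σ K :=
  fun T => (z T).divMonomial (Finsupp.single j 1)

lemma divX_contract (p j : σ) (z : Finset σ → MvPolynomial σ K) :
    divX j (contract p z) = contract p (divX j z) := by
  ext1 T
  by_cases h : p ∈ T <;> simp [divX, contract, h, divMonomial_smul]

variable [Fintype σ]

/-- The Koszul differential of the variables. -/
noncomputable def koszul :
    (Finset σ → MvPolynomial σ K) →ₗ[MvPolynomial σ K] (Finset σ → MvPolynomial σ K) where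
  toFun z T := ∑ j, X j * contract j z T
  map_add' z w := by
    ext1 T
    simp only [Pi.add_apply, ← Finset.sum_add_distrib, ← mul_add]
    refine Finset.sum_congr rfl fun j _ => ?_
    by_cases h : j ∈ T <;> simp [contract, h]
  map_smul' a z := by
    ext1 T
    simp only [Pi.smul_apply, smul_eq_mul, Finset.mul_sum, RingHom.id_apply]
    refine Finset.sum_congr rfl fun j _ => ?_
    by_cases h : j ∈ T <;> simp [contract, h, mul_left_comm]

lemma koszul_apply (z : Finset σ → MvPolynomial σ K) (T : Finset σ) :
    koszul z T = ∑ j, X j * contract j z T := rfl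

theorem koszul_koszul (z : Finset σ → MvPolynomial σ K) : koszul (koszul z) = 0 := by
  ext1 T
  have h1 : koszul (koszul z) T
      = ∑ x : σ × σ, X x.1 * (X x.2 * contract x.1 (contract x.2 z) T) := by
    rw [koszul_apply, Fintype.sum_prod_type]
    refine Finset.sum_congr rfl fun p _ => ?_
    rw [← Finset.mul_sum (s := Finset.univ) (a := X p)
      (f := fun q => X q * contract p (contract q z) T)]
    congr 1
    exact contract_sum Finset.univ p X (fun j => contract j z) T
  rw [h1]
  refine Finset.sum_involution (fun x _ => x.swap) (fun x _ => ?_) (fun x _ hx h => hx ?_)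
    (fun _ _ => Finset.mem_univ _) (fun _ _ => Prod.swap_swap _)
  · rw [Prod.fst_swap, Prod.snd_swap, mul_left_comm, ← mul_add, ← mul_add, contract_contract,
      mul_zero, mul_zero]
  · obtain ⟨p, q⟩ := x
    obtain rfl : q = p := congrArg Prod.fst h
    rw [contract_self, mul_zero, mul_zero]

/-- The homotopy in direction `j` for the Koszul complex. -/
lemma koszul_homotopy (j : σ) (z : Finset σ → MvPolynomial σ K) (T : Finset σ) :
    koszul (wedge j (divX j z)) T + wedge j (divX j (koszul z)) T
      = z T - if j ∈ T then 0 else (z T).modMonomial (Finsupp.single j 1) := by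
  have h1 : divX j (koszul z) = fun U => ∑ p, (X p * contract p z U).divMonomial
      (Finsupp.single j 1) := by
    ext1 U
    exact divMonomial_sum _ _ _
  have h2 : wedge j (divX j (koszul z)) T = ∑ p, wedge j
      (fun U => (X p * contract p z U).divMonomial (Finsupp.single j 1)) T := by
    rw [h1]
    by_cases h : j ∈ T <;> simp [wedge, h, Finset.smul_sum]
  rw [h2, koszul_apply, ← Finset.sum_add_distrib, Finset.sum_eq_single j]
  · simp only [X_mul_divMonomial]
    have h3 := wedge_contract_self j z T
    have h4 := contract_wedge_self j (divX j z) T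
    rw [show (fun U => contract j z U) = contract j z from rfl, h3, h4]
    split_ifs with h
    · simp
    · have := divMonomial_add_modMonomial_single (z T) j
      rw [add_zero, eq_sub_iff_add_eq]
      exact this
  · intro p _ hpj
    simp only [divMonomial_X_mul_of_ne hpj]
    have h3 : wedge j (fun U => X p * (contract p z U).divMonomial (Finsupp.single j 1)) T
        = X p * wedge j (contract p (divX j z)) T := by
      rw [← divX_contract]
      by_cases h : j ∈ T <;> simp [wedge, divX, h]
    rw [h3, ← mul_add, contract_wedge hpj, mul_zero]
  · simp

lemma constantCoeff_koszul_empty (z : Finset σ → MvPolynomial σ K) (T : Finset σ) :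
    constantCoeff (koszul z T) = 0 := by
  simp [koszul_apply]

/-- A cycle is homologous to one that does not involve the variables in `A`. -/
lemma exists_koszul_reduced (A : Finset σ) {z : Finset σ → MvPolynomial σ K}
    (hz : koszul z = 0) : ∃ w : Finset σ → MvPolynomial σ K, ∀ j ∈ A, ∀ T,
      (j ∈ T → (z - koszul w) T = 0) ∧ ∀ m : σ →₀ ℕ, m j ≠ 0 → coeff m ((z - koszul w) T) = 0 := by
  classical
  induction A using Finset.induction with
  | empty => exact ⟨0, by simp⟩
  | insert j A _ ih =>
    obtain ⟨w, hw⟩ := ih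
    obtain ⟨y, hy⟩ : ∃ y, y = z - koszul w := ⟨_, rfl⟩
    rw [← hy] at hw
    have hy0 : koszul y = 0 := by rw [hy, map_sub, hz, koszul_koszul, sub_zero]
    have hred : ∀ T, (z - koszul (w + wedge j (divX j y))) T
        = if j ∈ T then 0 else (y T).modMonomial (Finsupp.single j 1) := by
      intro T
      have h := koszul_homotopy j y T
      have h0 : wedge j (divX j (koszul y)) T = 0 := by
        rw [hy0]
        by_cases h : j ∈ T <;> simp [wedge, divX, h]
      rw [h0, add_zero] at h
      rw [map_add, ← sub_sub, ← hy, Pi.sub_apply, h, sub_sub_cancel]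
    refine ⟨w + wedge j (divX j y), fun i hi T => ?_⟩
    rw [hred]
    by_cases hjT : j ∈ T
    · simp [hjT]
    rw [if_neg hjT]
    rcases Finset.mem_insert.1 hi with rfl | hi
    · refine ⟨fun h => absurd h hjT, fun m hm => coeff_modMonomial_of_le _ ?_⟩
      exact Finsupp.single_le_iff.2 (Nat.one_le_iff_ne_zero.2 hm)
    · refine ⟨fun h => ?_, fun m hm => ?_⟩
      · rw [(hw i hi T).1 h]
        simpa using X_mul_modMonomial j (0 : MvPolynomial σ K)
      · by_cases hle : Finsupp.single j 1 ≤ m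
        · exact coeff_modMonomial_of_le _ hle
        · rw [coeff_modMonomial_of_not_le _ hle]
          exact (hw i hi T).2 m hm

/-- Exactness of the Koszul complex. -/
theorem exists_eq_koszul {z : Finset σ → MvPolynomial σ K} (hz : koszul z = 0)
    (h0 : constantCoeff (z ∅) = 0) : ∃ w, koszul w = z := by
  obtain ⟨w, hw⟩ := exists_koszul_reduced Finset.univ hz
  refine ⟨w, (sub_eq_zero.1 ?_).symm⟩
  ext1 T
  rcases T.eq_empty_or_nonempty with rfl | ⟨j, hj⟩
  · ext m
    by_cases hm : m = 0
    · subst hm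
      have h1 := constantCoeff_koszul_empty w ∅
      rw [constantCoeff_eq] at h0 h1
      simp [h0, h1]
    · obtain ⟨j, hj⟩ := Finsupp.ne_iff.1 hm
      exact (hw j (Finset.mem_univ _) ∅).2 m hj
  · exact (hw j (Finset.mem_univ _) T).1 hj

end Koszul

section LinearStrand

variable {σ τ : Type*} [LinearOrder σ] [Fintype σ] {K : Type*} [CommRing K]

lemma exists_homogeneous_lift {ι κ : Type*} [Fintype κ] {M : ι → κ → MvPolynomial τ K} {d e : ℕ}
    (hM : ∀ j k, (M j k).IsHomogeneous d) {v : ι → MvPolynomial τ K}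
    (hv : ∀ j, (v j).IsHomogeneous (e + d))
    (h : ∃ w : κ → MvPolynomial τ K, v = fun j => ∑ k, M j k * w k) :
    ∃ w : κ → MvPolynomial τ K, (∀ k, (w k).IsHomogeneous e) ∧ (v = 0 → w = 0) ∧
      v = fun j => ∑ k, M j k * w k := by
  by_cases hv0 : v = 0
  · refine ⟨0, fun _ => isHomogeneous_zero _ _ _, fun _ => rfl, ?_⟩
    rw [hv0]; ext1 j; simp
  obtain ⟨w, hw⟩ := h
  refine ⟨fun k => homogeneousComponent e (w k), fun k => homogeneousComponent_isHomogeneous _ _,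
    fun h => absurd h hv0, ?_⟩
  ext1 j
  rw [← homogeneousComponent_eq_self (hv j), hw, map_sum]
  refine Finset.sum_congr rfl fun k _ => ?_
  rw [mul_comm, homogeneousComponent_mul_of_isHomogeneous _ (hM j k), mul_comm]

lemma koszul_isHomogeneous {z : Finset σ → MvPolynomial σ K} {e : ℕ}
    (hz : ∀ T, (z T).IsHomogeneous e) (T : Finset σ) : (koszul z T).IsHomogeneous (e + 1) := by
  refine IsHomogeneous.sum _ _ _ fun j _ => ?_
  rw [add_comm]
  refine (isHomogeneous_X K j).mul ?_
  by_cases h : j ∈ T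
  · simp only [contract, h, if_true]; exact isHomogeneous_zero _ _ _
  · simp only [contract, h, if_false, smul_eq_C_mul]; exact (hz _).C_mul _

lemma koszul_combination {κ : Type*} [Fintype κ] (a : κ → MvPolynomial σ K)
    (z : κ → Finset σ → MvPolynomial σ K) :
    koszul (fun T => ∑ k, a k * z k T) = fun T => ∑ k, a k * koszul (z k) T := by
  have h : ∀ y : κ → Finset σ → MvPolynomial σ K,
      (fun T => ∑ k, a k * y k T) = ∑ k, a k • y k := fun y => by
    ext1 T; simp [Finset.sum_apply]
  rw [h, h fun k => koszul (z k), map_sum]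
  simp_rw [map_smul]

/-- A Koszul cycle of large degree with values in a syzygy module of a linear complex bounds a
chain with values in that module. -/
theorem exists_koszul_eq_of_linear {r : ℕ → ℕ}
    {M : (i : ℕ) → Fin (r i) → Fin (r (i + 1)) → MvPolynomial σ K}
    (hM : ∀ i j k, (M i j k).IsHomogeneous 1)
    (hex : ∀ (i : ℕ) (v : Fin (r (i + 1)) → MvPolynomial σ K),
      ((fun j => ∑ k, M i j k * v k) = fun _ => 0) ↔
        ∃ w : Fin (r (i + 2)) → MvPolynomial σ K, v = fun k => ∑ l, M (i + 1) k l * w l)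
    (p : ℕ) : ∀ (i : ℕ) (z : Fin (r i) → Finset σ → MvPolynomial σ K) (e : ℕ),
      (∀ j T, (z j T).IsHomogeneous (e + 2)) → (∀ j T, p ≤ T.card → z j T = 0) →
      (∀ T, ∃ w : Fin (r (i + 1)) → MvPolynomial σ K,
        (fun j => z j T) = fun j => ∑ k, M i j k * w k) → (∀ j, koszul (z j) = 0) →
      ∃ y : Fin (r i) → Finset σ → MvPolynomial σ K,
        (∀ T, ∃ w : Fin (r (i + 1)) → MvPolynomial σ K,
        (fun j => y j T) = fun j => ∑ k, M i j k * w k) ∧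
        ∀ j, koszul (y j) = z j := by
  induction p with
  | zero =>
    intro i z e _ hz _ _
    have : z = 0 := by ext1 j; ext1 T; exact hz j T (Nat.zero_le _)
    refine ⟨0, fun T => ⟨0, ?_⟩, fun j => ?_⟩
    · ext1 j; simp
    · simp [this]
  | succ p ih =>
    intro i z e hdeg hz hlift hcyc
    choose c hcdeg hc0 hc using fun T => exists_homogeneous_lift (hM i) (e := e + 1)
      (fun j => hdeg j T) (hlift T)
    have hzc : ∀ j, z j = fun T => ∑ k, M i j k * c T k := fun j => by
      ext1 T; exact congrFun (hc T) j
    have hcker : ∀ T, (fun j => ∑ k, M i j k * koszul (fun U => c U k) T) = fun _ => 0 := by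
      intro T
      ext1 j
      have h := hcyc j
      rw [hzc j, koszul_combination (M i j) (fun k U => c U k)] at h
      exact congrFun h T
    obtain ⟨y, hy, hyc⟩ := ih (i + 1) (fun k => koszul fun U => c U k) e
      (fun k T => koszul_isHomogeneous (fun U => hcdeg U k) T)
      (fun k T hT => by
        refine Finset.sum_eq_zero fun j _ => ?_
        by_cases hj : j ∈ T
        · simp [contract, hj]
        · have : c (insert j T) = 0 := hc0 _ (by
            ext1 l
            exact hz l _ (by rw [Finset.card_insert_of_notMem hj]; omega))
          simp [contract, hj, this])
      (fun T => (hex i _).1 (hcker T)) (fun k => koszul_koszul _)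
    have hex' : ∀ k, ∃ w, koszul w = (fun U => c U k) - y k := by
      intro k
      refine exists_eq_koszul (by rw [map_sub, hyc k, sub_self]) ?_
      obtain ⟨w, hw⟩ := hy ∅
      have h1 : constantCoeff (c ∅ k) = 0 := by
        rw [constantCoeff_eq]
        exact (hcdeg ∅ k).coeff_eq_zero (by simp)
      have h2 : constantCoeff (y k ∅) = 0 := by
        rw [congrFun hw k, map_sum]
        refine Finset.sum_eq_zero fun l _ => ?_
        rw [map_mul, constantCoeff_eq, (hM (i + 1) k l).coeff_eq_zero (by simp), zero_mul]
      simp [h1, h2]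
    choose w hw using hex'
    refine ⟨fun j T => ∑ k, M i j k * w k T, fun T => ⟨fun k => w k T, rfl⟩, fun j => ?_⟩
    rw [koszul_combination]
    ext1 T
    have h1 := congrFun ((hex i fun k => y k T).2 (hy T)) j
    simp only [hw, Pi.sub_apply, mul_sub, Finset.sum_sub_distrib]
    rw [h1, sub_zero, hzc j]

/-- If `I` has a `d`-linear resolution, a Koszul chain of degree at least `d` whose boundary has
values in `I` is homologous, modulo `I`, to zero. -/
theorem HasLinearResolution.exists_sub_koszul_mem {F : Type*} [Field F]
    {I : Ideal (MvPolynomial σ F)} {d : ℕ} (hI : HasLinearResolution I d) (hd : 1 ≤ d)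
    {ω : Finset σ → MvPolynomial σ F} (hω : ∀ T, (ω T).IsHomogeneous d)
    (hmem : ∀ T, koszul ω T ∈ I) :
    ∃ η : Finset σ → MvPolynomial σ F, ∀ T, ω T - koszul η T ∈ I := by
  obtain ⟨r, g, M, hg, rfl, hM, hex0, hex⟩ := hI
  have hmem' : ∀ T, ∃ c : Fin (r 0) → MvPolynomial σ F, (fun _ : Unit => koszul ω T)
      = fun _ => ∑ k, g k * c k := by
    intro T
    obtain ⟨c, hc⟩ := (Submodule.mem_span_range_iff_exists_fun _).1 (hmem T)
    refine ⟨c, ?_⟩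
    ext1
    rw [← hc]
    exact Finset.sum_congr rfl fun k _ => by rw [smul_eq_mul, mul_comm]
  choose c hcdeg _ hc using fun T => exists_homogeneous_lift (M := fun (_ : Unit) k => g k)
    (fun _ k => hg k) (e := 1)
    (fun _ => by rw [add_comm]; exact koszul_isHomogeneous hω T) (hmem' T)
  replace hc : koszul ω = fun T => ∑ k, g k * c T k := by
    ext1 T; exact congrFun (hc T) ()
  have hker : ∀ T, ∑ k, koszul (fun U => c U k) T * g k = 0 := by
    intro T
    have h := koszul_combination g (fun k U => c U k)
    rw [← hc, koszul_koszul] at h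
    rw [← show (0 : Finset σ → MvPolynomial σ F) T = 0 from rfl, h]
    exact Finset.sum_congr rfl fun k _ => mul_comm _ _
  obtain ⟨y, hy, hyc⟩ := exists_koszul_eq_of_linear hM hex (Fintype.card σ + 1) 0
    (fun k => koszul fun U => c U k) 0
    (fun k T => koszul_isHomogeneous (fun U => hcdeg U k) T)
    (fun k T hT => absurd (Finset.card_le_univ T) (by omega))
    (fun T => (hex0 _).1 (hker T)) (fun k => koszul_koszul _)
  have hex' : ∀ k, ∃ w, koszul w = (fun U => c U k) - y k := by
    intro k
    refine exists_eq_koszul (by rw [map_sub, hyc k, sub_self]) ?_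
    obtain ⟨w, hw⟩ := hy ∅
    have h1 : constantCoeff (c ∅ k) = 0 := by
      rw [constantCoeff_eq]
      exact (hcdeg ∅ k).coeff_eq_zero (by simp)
    have h2 : constantCoeff (y k ∅) = 0 := by
      rw [congrFun hw k, map_sum]
      refine Finset.sum_eq_zero fun l _ => ?_
      rw [map_mul, constantCoeff_eq, (hM 0 k l).coeff_eq_zero (by simp), zero_mul]
    simp [h1, h2]
  choose w hw using hex'
  obtain ⟨η, hη⟩ : ∃ η, koszul η = ω - fun T => ∑ k, g k * w k T := by
    refine exists_eq_koszul ?_ ?_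
    · rw [map_sub, koszul_combination, hc, sub_eq_zero]
      ext1 T
      have h1 := (hex0 fun k => y k T).2 (hy T)
      simp only [hw, Pi.sub_apply, mul_sub, Finset.sum_sub_distrib]
      rw [Finset.sum_congr rfl fun k _ => mul_comm (g k) (y k T), h1, sub_zero]
    · have h1 : constantCoeff (ω ∅) = 0 := by
        rw [constantCoeff_eq]
        exact (hω ∅).coeff_eq_zero (by simp; omega)
      have h2 : ∀ k, constantCoeff (g k) = 0 := fun k => by
        rw [constantCoeff_eq]
        exact (hg k).coeff_eq_zero (by simp; omega)
      simp [h1, h2]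
  refine ⟨η, fun T => ?_⟩
  rw [hη, Pi.sub_apply, sub_sub_cancel]
  exact Ideal.sum_mem _ fun k _ => Ideal.mul_mem_right _ _ (Ideal.subset_span ⟨k, rfl⟩)

end LinearStrand

section QuadraticRelations

variable {σ : Type*} [LinearOrder σ] [Fintype σ] {K : Type*} [Field K]

/-- The ideal contains every monomial that occurs in one of its members. -/
def HasMonomialMembers {τ : Type*} (I : Ideal (MvPolynomial τ K)) : Prop :=
  ∀ f ∈ I, ∀ m : τ →₀ ℕ, coeff m f ≠ 0 → (monomial m (1 : K) : MvPolynomial τ K) ∈ I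

lemma monomial_single_add_single {τ : Type*} (p q : τ) :
    (monomial (Finsupp.single p 1 + Finsupp.single q 1) (1 : K) : MvPolynomial τ K)
      = X p * X q := by
  simp [X, monomial_mul]

lemma coeff_single_add_single_X_mul {τ : Type*} [DecidableEq τ] {p q : τ} (hpq : p ≠ q) (j : τ)
    (f : MvPolynomial τ K) :
    coeff (Finsupp.single p 1 + Finsupp.single q 1) (X j * f)
      = (if j = p then coeff (Finsupp.single q 1) f else 0)
        + if j = q then coeff (Finsupp.single p 1) f else 0 := by
  by_cases hp : j = p
  · subst hp
    rw [if_pos rfl, if_neg hpq, add_zero, coeff_X_mul]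
  by_cases hq : j = q
  · subst hq
    rw [if_neg hp, if_pos rfl, zero_add, add_comm, coeff_X_mul]
  rw [if_neg hp, if_neg hq, add_zero, coeff_X_mul', if_neg]
  simp [hp, hq]

lemma coeff_koszul {p q : σ} (hpq : p ≠ q) (η : Finset σ → MvPolynomial σ K) (T : Finset σ) :
    coeff (Finsupp.single p 1 + Finsupp.single q 1) (koszul η T)
      = coeff (Finsupp.single q 1) (contract p η T)
        + coeff (Finsupp.single p 1) (contract q η T) := by
  rw [koszul_apply, coeff_sum]
  simp only [coeff_single_add_single_X_mul hpq, Finset.sum_add_distrib, Finset.sum_ite_eq',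
    Finset.mem_univ, if_true]

lemma coeff_koszul_erase_erase {p q : σ} (hpq : p ≠ q) {W : Finset σ} (hp : p ∈ W) (hq : q ∈ W)
    (η : Finset σ → MvPolynomial σ K) :
    coeff (Finsupp.single p 1 + Finsupp.single q 1) (koszul η ((W.erase p).erase q))
      = insertSign K p ((W.erase p).erase q) * insertSign K q (W.erase q) *
        (insertSign K q (W.erase q) * coeff (Finsupp.single q 1) (η (W.erase q))
          - insertSign K p (W.erase p) * coeff (Finsupp.single p 1) (η (W.erase p))) := by
  obtain ⟨T, hT⟩ : ∃ T, T = (W.erase p).erase q := ⟨_, rfl⟩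
  have hpT : p ∉ T := by simp [hT]
  have hqT : q ∉ T := by simp [hT]
  have h1 : W.erase p = insert q T := by rw [hT, Finset.insert_erase (by simp [hq, hpq.symm])]
  have h2 : W.erase q = insert p T := by
    rw [hT, Finset.erase_right_comm, Finset.insert_erase (by simp [hp, hpq])]
  rw [coeff_koszul hpq, ← hT, h1, h2]
  simp only [contract, hpT, hqT, if_false, coeff_smul, smul_eq_mul]
  have h3 := insertSign_swap (K := K) hpq hpT hqT
  linear_combination
    -(insertSign K p T * coeff (Finsupp.single q 1) (η (insert p T))) *
        insertSign_mul_self (K := K) q (insert p T)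
      + (insertSign K p (insert q T) * coeff (Finsupp.single p 1) (η (insert q T))) * h3
      - (insertSign K q T * coeff (Finsupp.single p 1) (η (insert q T))) *
        insertSign_mul_self (K := K) p (insert q T)

lemma koszul_single_mem {I : Ideal (MvPolynomial σ K)} {U : Finset σ} {f : MvPolynomial σ K}
    (h : ∀ j ∈ U, X j * f ∈ I) (T : Finset σ) :
    koszul (Pi.single U f : Finset σ → MvPolynomial σ K) T ∈ I := by
  refine Ideal.sum_mem _ fun j _ => ?_
  by_cases hj : j ∈ T
  · simp [contract, hj]
  by_cases hU : insert j T = U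
  · have : j ∈ U := hU ▸ Finset.mem_insert_self _ _
    simp only [contract, hj, if_false, hU, Pi.single_eq_same, smul_eq_C_mul]
    rw [mul_left_comm]
    exact Ideal.mul_mem_left _ _ (h j this)
  · simp [contract, hj, Pi.single_eq_of_ne hU]

lemma isHomogeneous_single {τ : Type*} [DecidableEq τ] {U : Finset τ} {f : MvPolynomial τ K} {d : ℕ}
    (hf : f.IsHomogeneous d) (T : Finset τ) :
    ((Pi.single U f : Finset τ → MvPolynomial τ K) T).IsHomogeneous d := by
  by_cases h : T = U
  · subst h; simpa using hf
  · rw [Pi.single_eq_of_ne h]; exact isHomogeneous_zero _ _ _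

/-- The first consequence of linearity: a square dominates an end of each edge. -/
theorem HasLinearResolution.mul_mem_of_sq_mem {I : Ideal (MvPolynomial σ K)}
    (hI : HasLinearResolution I 2) (hmon : HasMonomialMembers I) (i j k : σ)
    (hk : (X k * X k : MvPolynomial σ K) ∈ I) (hij : (X i * X j : MvPolynomial σ K) ∈ I) :
    (X i * X k : MvPolynomial σ K) ∈ I ∨ (X j * X k : MvPolynomial σ K) ∈ I := by
  by_contra! hc
  have hik : k ≠ i := by rintro rfl; exact hc.1 hk
  have hjk : k ≠ j := by rintro rfl; exact hc.2 hk
  have hki : (monomial (Finsupp.single k 1 + Finsupp.single i 1) (1 : K) :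
      MvPolynomial σ K) ∉ I := by
    rw [monomial_single_add_single, mul_comm]; exact hc.1
  have hkj : (monomial (Finsupp.single k 1 + Finsupp.single j 1) (1 : K) :
      MvPolynomial σ K) ∉ I := by
    rw [monomial_single_add_single, mul_comm]; exact hc.2
  obtain ⟨η, hη⟩ := hI.exists_sub_koszul_mem (by norm_num)
    (ω := Pi.single {k, i} (X k * X j))
    (isHomogeneous_single ((isHomogeneous_X K k).mul (isHomogeneous_X K j)))
    (koszul_single_mem fun l hl => by
      rcases Finset.mem_insert.1 hl with rfl | hl
      · rw [← mul_assoc]; exact Ideal.mul_mem_right _ _ hk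
      · rw [Finset.mem_singleton.1 hl, mul_left_comm]; exact Ideal.mul_mem_left _ _ hij)
  have h1 : coeff (Finsupp.single k 1 + Finsupp.single j 1)
      ((X k * X j : MvPolynomial σ K) - koszul η {k, i}) = 0 := by
    by_contra h
    refine hkj (hmon _ ?_ _ h)
    simpa using hη {k, i}
  rw [coeff_sub, ← monomial_single_add_single, coeff_monomial, if_pos rfl, coeff_koszul hjk] at h1
  by_cases hij' : i = j
  · subst hij'
    simp [contract] at h1
  have h2 : coeff (Finsupp.single k 1 + Finsupp.single i 1) (koszul η {k, j}) = 0 := by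
    by_contra h
    refine hki (hmon (koszul η {k, j}) ?_ _ h)
    have h3 := hη {k, j}
    have hne : ({k, j} : Finset σ) ≠ {k, i} := fun h => by
      have : i ∈ ({k, j} : Finset σ) := h ▸ by simp
      simp [hik.symm, hij'] at this
    rw [Pi.single_eq_of_ne hne, zero_sub] at h3
    exact (Ideal.neg_mem_iff _).1 h3
  rw [coeff_koszul hik] at h2
  have h4 : insertSign K i {k, j} * coeff (Finsupp.single k 1) (η {j, k, i}) = 0 := by
    have : ({i, k, j} : Finset σ) = {j, k, i} := by ext; simp; tauto
    simpa [contract, hik.symm, hij', this] using h2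
  have h5 : coeff (Finsupp.single k 1) (η {j, k, i}) = 0 := by
    have := insertSign_mul_self (K := K) i {k, j}
    linear_combination insertSign K i {k, j} * h4
      - coeff (Finsupp.single k 1) (η {j, k, i}) * this
  simp [contract, hjk.symm, Ne.symm hij', h5] at h1

/-- The second consequence of linearity, which forces the complementary graph to be chordal. -/
theorem HasLinearResolution.hasSeparatingFunctions {I : Ideal (MvPolynomial σ K)}
    (hI : HasLinearResolution I 2) (hmon : HasMonomialMembers I) :
    HasSeparatingFunctions K fun p q : σ => p ≠ q ∧ (X p * X q : MvPolynomial σ K) ∉ I := by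
  intro B v s t hvB hsB htB hst hsv htv hNst hvb hNsv
  have hst' : (X s * X t : MvPolynomial σ K) ∈ I := by
    by_contra h; exact hNst ⟨hst, h⟩
  have hvb' : ∀ b ∈ B, (X v * X b : MvPolynomial σ K) ∈ I := fun b hb => by
    by_contra h; exact hvb b hb ⟨fun h => hvB (h ▸ hb), h⟩
  obtain ⟨W, hW⟩ : ∃ W, W = insert s (insert t (insert v B)) := ⟨_, rfl⟩
  rw [← hW]
  have hsW : s ∈ W := by simp [hW]
  have hvW : v ∈ W := by simp [hW]
  obtain ⟨η, hη⟩ := hI.exists_sub_koszul_mem (by norm_num)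
    (ω := Pi.single ((W.erase s).erase v) (X s * X v))
    (isHomogeneous_single ((isHomogeneous_X K s).mul (isHomogeneous_X K v)))
    (koszul_single_mem fun l hl => by
      simp only [hW, Finset.mem_erase, Finset.mem_insert] at hl
      obtain ⟨hlv, hls, h | rfl | h | h⟩ := hl
      · exact absurd h hls
      · rw [← mul_assoc, mul_comm (X l)]; exact Ideal.mul_mem_right _ _ hst'
      · exact absurd h hlv
      · rw [mul_left_comm, mul_comm (X l)]; exact Ideal.mul_mem_left _ _ (hvb' l h))
  have hcoeff : ∀ p q, p ≠ q → (X p * X q : MvPolynomial σ K) ∉ I → ∀ T,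
      coeff (Finsupp.single p 1 + Finsupp.single q 1)
        ((Pi.single ((W.erase s).erase v) (X s * X v) : Finset σ → MvPolynomial σ K) T)
      = coeff (Finsupp.single p 1 + Finsupp.single q 1) (koszul η T) := by
    intro p q _ hpqI T
    by_contra h
    refine hpqI ?_
    rw [← monomial_single_add_single]
    refine hmon _ (hη T) _ ?_
    rwa [coeff_sub, sub_ne_zero]
  refine ⟨fun q => insertSign K q (W.erase q) * coeff (Finsupp.single q 1) (η (W.erase q)),
    fun h => ?_, fun p hp q hq hpq h1 h2 => ?_⟩
  · have h3 := hcoeff s v hsv hNsv.2 ((W.erase s).erase v)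
    rw [Pi.single_eq_same, coeff_koszul_erase_erase hsv hsW hvW, ← monomial_single_add_single,
      coeff_monomial, if_pos rfl] at h3
    simp only at h
    rw [h, sub_self, mul_zero] at h3
    exact one_ne_zero h3
  · have h3 := hcoeff p q hpq.1 hpq.2 ((W.erase p).erase q)
    have hne : (W.erase p).erase q ≠ (W.erase s).erase v := by
      intro h
      have hs : s ∉ (W.erase p).erase q := by rw [h]; simp
      have hv : v ∉ (W.erase p).erase q := by rw [h]; simp
      simp only [Finset.mem_erase, hsW, hvW, and_true, not_and, not_not, ne_eq] at hs hv
      by_cases hsq : s = q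
      · by_cases hvq : v = q
        · exact hsv (hsq.trans hvq.symm)
        · exact h2 ⟨(hv hvq).symm, hsq.symm⟩
      · by_cases hvq : v = q
        · exact h1 ⟨(hs hsq).symm, hvq.symm⟩
        · exact hsv ((hs hsq).trans (hv hvq).symm)
    rw [Pi.single_eq_of_ne hne, coeff_zero, coeff_koszul_erase_erase hpq.1 hp hq] at h3
    have h4 := insertSign_mul_self (K := K) p ((W.erase p).erase q)
    have h5 := insertSign_mul_self (K := K) q (W.erase q)
    have h6 : insertSign K p ((W.erase p).erase q) * insertSign K q (W.erase q) ≠ 0 :=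
      mul_ne_zero (left_ne_zero_of_mul_eq_one h4) (left_ne_zero_of_mul_eq_one h5)
    exact (sub_eq_zero.1 ((mul_eq_zero.1 h3.symm).resolve_left h6)).symm

end QuadraticRelations

section LinearSyzygies

variable {σ K : Type*} [Field K]

/-- The submodule has a (possibly infinite) resolution by matrices of linear forms, expressed by a
family of submodules which is closed under passing to syzygies. -/
def HasLinearSyzygies {ι : Type} [Fintype ι]
    (N : Submodule (MvPolynomial σ K) (ι → MvPolynomial σ K)) : Prop :=
  ∃ P : ∀ (κ : Type) [Fintype κ], Submodule (MvPolynomial σ K) (κ → MvPolynomial σ K) → Prop,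
    P ι N ∧ ∀ (κ : Type) [Fintype κ] (L : Submodule (MvPolynomial σ K) (κ → MvPolynomial σ K)),
      P κ L → ∃ (μ : Type) (_ : Fintype μ) (h : μ → κ → MvPolynomial σ K),
        (∀ a b, (h a b).IsHomogeneous 1) ∧ L = Submodule.span (MvPolynomial σ K) (Set.range h) ∧
          P μ (LinearMap.ker (Fintype.linearCombination (MvPolynomial σ K) h))

lemma HasLinearSyzygies.exists_generators {ι : Type} [Fintype ι]
    {N : Submodule (MvPolynomial σ K) (ι → MvPolynomial σ K)} (hN : HasLinearSyzygies N) :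
    ∃ (μ : Type) (_ : Fintype μ) (h : μ → ι → MvPolynomial σ K),
      (∀ a b, (h a b).IsHomogeneous 1) ∧ N = Submodule.span (MvPolynomial σ K) (Set.range h) ∧
        HasLinearSyzygies (LinearMap.ker (Fintype.linearCombination (MvPolynomial σ K) h)) := by
  obtain ⟨P, hP, hcl⟩ := hN
  obtain ⟨μ, _, h, h1, h2, h3⟩ := hcl ι N hP
  exact ⟨μ, _, h, h1, h2, P, h3, hcl⟩

lemma HasLinearSyzygies.of_generators {ι μ : Type} [Fintype ι] [Fintype μ]
    {N : Submodule (MvPolynomial σ K) (ι → MvPolynomial σ K)} (h : μ → ι → MvPolynomial σ K)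
    (hlin : ∀ a b, (h a b).IsHomogeneous 1)
    (hN : N = Submodule.span (MvPolynomial σ K) (Set.range h))
    (hsyz : HasLinearSyzygies (LinearMap.ker (Fintype.linearCombination (MvPolynomial σ K) h))) :
    HasLinearSyzygies N := by
  refine ⟨fun κ _ L => HasLinearSyzygies L ∨ ∃ (μ : Type) (_ : Fintype μ)
    (h : μ → κ → MvPolynomial σ K), (∀ a b, (h a b).IsHomogeneous 1) ∧
      L = Submodule.span (MvPolynomial σ K) (Set.range h) ∧
        HasLinearSyzygies (LinearMap.ker (Fintype.linearCombination (MvPolynomial σ K) h)),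
    .inr ⟨μ, _, h, hlin, hN, hsyz⟩, ?_⟩
  rintro κ _ L (hL | ⟨μ, _, h, h1, h2, h3⟩)
  · obtain ⟨μ, _, h, h1, h2, h3⟩ := hL.exists_generators
    exact ⟨μ, _, h, h1, h2, .inl h3⟩
  · exact ⟨μ, _, h, h1, h2, .inl h3⟩

lemma mem_ker_linearCombination {R M μ : Type*} [CommRing R] [AddCommGroup M] [Module R M]
    [Fintype μ] {h : μ → M} {w : μ → R} :
    w ∈ LinearMap.ker (Fintype.linearCombination R h) ↔ ∑ a, w a • h a = 0 := by
  rw [LinearMap.mem_ker, Fintype.linearCombination_apply]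

/-- An extension of modules with linear syzygies along which linear elements can be lifted. -/
inductive IsLinearExtension : ∀ (κ : Type) [Fintype κ],
    Submodule (MvPolynomial σ K) (κ → MvPolynomial σ K) → Prop
  | mk (α γ : Type) [Fintype α] [Fintype γ]
      (A : Submodule (MvPolynomial σ K) (α → MvPolynomial σ K))
      (C : Submodule (MvPolynomial σ K) (γ → MvPolynomial σ K))
      (N : Submodule (MvPolynomial σ K) (α ⊕ γ → MvPolynomial σ K))
      (hA : HasLinearSyzygies A) (hC : HasLinearSyzygies C)
      (hleft : ∀ v, v ∈ A ↔ Sum.elim v 0 ∈ N)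
      (hright : ∀ v w, Sum.elim v w ∈ N → w ∈ C)
      (hlift : ∀ w ∈ C, (∀ c, (w c).IsHomogeneous 1) →
        ∃ v, (∀ a, (v a).IsHomogeneous 1) ∧ Sum.elim v w ∈ N) :
      IsLinearExtension (α ⊕ γ) N

lemma exists_homogeneous_coefficients {ι μ : Type} [Fintype μ] {d e : ℕ}
    {h : μ → ι → MvPolynomial σ K} (hh : ∀ a b, (h a b).IsHomogeneous d)
    {v : ι → MvPolynomial σ K} (hv : ∀ b, (v b).IsHomogeneous (e + d))
    (hmem : v ∈ Submodule.span (MvPolynomial σ K) (Set.range h)) :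
    ∃ w : μ → MvPolynomial σ K, (∀ a, (w a).IsHomogeneous e) ∧ ∑ a, w a • h a = v := by
  have hsum : ∀ w : μ → MvPolynomial σ K, ∑ a, w a • h a = fun b => ∑ a, h a b * w a := fun w => by
    ext1 b; simp [Finset.sum_apply, mul_comm]
  obtain ⟨w, hw⟩ := (Submodule.mem_span_range_iff_exists_fun _).1 hmem
  obtain ⟨w', h1, -, h2⟩ := exists_homogeneous_lift (M := fun b a => h a b) (fun b a => hh a b) hv
    ⟨w, by rw [← hw, hsum]⟩
  exact ⟨w', h1, by rw [hsum, ← h2]⟩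

/-- The horseshoe lemma for linear syzygies. -/
theorem IsLinearExtension.hasLinearSyzygies {ι : Type} [Fintype ι]
    {L : Submodule (MvPolynomial σ K) (ι → MvPolynomial σ K)} (hL : IsLinearExtension ι L) :
    HasLinearSyzygies L := by
  refine ⟨fun κ _ => IsLinearExtension κ, hL, ?_⟩
  clear hL L
  rintro _ _ _ ⟨α, γ, A, C, N, hA, hC, hleft, hright, hlift⟩
  obtain ⟨α', _, p, hp, rfl, hpsyz⟩ := hA.exists_generators
  obtain ⟨γ', _, q, hq, rfl, hqsyz⟩ := hC.exists_generators
  choose l hl hlN using fun c => hlift (q c) (Submodule.subset_span ⟨c, rfl⟩) (hq c)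
  have hpN : ∀ a, Sum.elim (p a) 0 ∈ N := fun a => (hleft _).1 (Submodule.subset_span ⟨a, rfl⟩)
  have hsum : ∀ (v : α' → MvPolynomial σ K) (w : γ' → MvPolynomial σ K),
      ∑ x, Sum.elim v w x •
          (Sum.elim (fun a => Sum.elim (p a) (0 : γ → MvPolynomial σ K))
            (fun c => Sum.elim (l c) (q c)) x : α ⊕ γ → MvPolynomial σ K)
        = Sum.elim (∑ a, v a • p a + ∑ c, w c • l c) (∑ c, w c • q c) := by
    intro v w
    rw [Fintype.sum_sum_type]
    ext1 b
    cases b <;> simp [Finset.sum_apply]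
  refine ⟨α' ⊕ γ', inferInstance, Sum.elim (fun a => Sum.elim (p a) 0)
    (fun c => Sum.elim (l c) (q c)), ?_, le_antisymm ?_ ?_, ?_⟩
  · rintro (a | c) (b | b)
    exacts [hp a b, isHomogeneous_zero _ _ _, hl c b, hq c b]
  · intro x hx
    obtain ⟨v, w, rfl⟩ : ∃ v w, Sum.elim v w = x := ⟨x ∘ Sum.inl, x ∘ Sum.inr, by simp⟩
    obtain ⟨b, hb⟩ := (Submodule.mem_span_range_iff_exists_fun _).1 (hright _ _ hx)
    have h1 : Sum.elim (v - ∑ c, b c • l c) 0 ∈ N := by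
      have h2 : ∑ c, b c • Sum.elim (l c) (q c) ∈ N :=
        Submodule.sum_mem _ fun c _ => N.smul_mem _ (hlN c)
      convert N.sub_mem hx h2 using 1
      ext1 k
      cases k <;> simp [← hb, Finset.sum_apply]
    obtain ⟨a, ha⟩ := (Submodule.mem_span_range_iff_exists_fun _).1 ((hleft _).2 h1)
    refine (Submodule.mem_span_range_iff_exists_fun _).2 ⟨Sum.elim a b, ?_⟩
    rw [hsum, ha, hb, sub_add_cancel]
  · rw [Submodule.span_le]
    rintro _ ⟨a | c, rfl⟩
    exacts [hpN a, hlN c]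
  · refine .mk α' γ' _ _ _ hpsyz hqsyz (fun v => ?_) (fun v w h => ?_) fun w hw hdeg => ?_
    · rw [mem_ker_linearCombination, mem_ker_linearCombination, hsum]
      constructor
      · intro h
        simp [h]
      · intro h
        ext1 b
        simpa using congrFun h (Sum.inl b)
    · rw [mem_ker_linearCombination, hsum] at h
      rw [mem_ker_linearCombination]
      ext1 b
      simpa using congrFun h (Sum.inr b)
    · rw [mem_ker_linearCombination] at hw
      have h1 : ∑ c, w c • l c ∈ Submodule.span (MvPolynomial σ K) (Set.range p) := by
        refine (hleft _).2 ?_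
        have h2 : ∑ c, w c • Sum.elim (l c) (q c) ∈ N :=
          Submodule.sum_mem _ fun c _ => N.smul_mem _ (hlN c)
        convert h2 using 1
        ext1 k
        cases k with
        | inl k => simp [Finset.sum_apply]
        | inr k => simpa [Finset.sum_apply] using (congrFun hw k).symm
      obtain ⟨v, hv, hvsum⟩ := exists_homogeneous_coefficients (e := 1) hp (fun b => by
        rw [Finset.sum_apply]
        exact IsHomogeneous.sum _ _ _ fun c _ => (hdeg c).mul (hl c b)) h1
      refine ⟨-v, fun a => (hv a).neg, ?_⟩
      rw [mem_ker_linearCombination, hsum, hw]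
      simp [hvsum]

/-- The colon ideal `J : f`, as a submodule of a free module of rank one. -/
def colonModule (J : Ideal (MvPolynomial σ K)) (f : MvPolynomial σ K) :
    Submodule (MvPolynomial σ K) (Unit → MvPolynomial σ K) where
  carrier := {w | w () * f ∈ J}
  add_mem' := fun {a b} ha hb => by
    simp only [Set.mem_ofPred_eq, Pi.add_apply, add_mul] at *
    exact J.add_mem ha hb
  zero_mem' := by simp
  smul_mem' := fun c w hw => by
    simp only [Set.mem_ofPred_eq, Pi.smul_apply, smul_eq_mul, mul_assoc] at *
    exact J.mul_mem_left _ hw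

lemma mem_colonModule {J : Ideal (MvPolynomial σ K)} {f : MvPolynomial σ K}
    {w : Unit → MvPolynomial σ K} : w ∈ colonModule J f ↔ w () * f ∈ J := Iff.rfl

lemma HasLinearSyzygies.sumElim {ι : Type} [Fintype ι] {d : ℕ} {g : ι → MvPolynomial σ K}
    {f : MvPolynomial σ K} (hg : ∀ i, (g i).IsHomogeneous d) (hf : f.IsHomogeneous d)
    (hsyz : HasLinearSyzygies (LinearMap.ker (Fintype.linearCombination (MvPolynomial σ K) g)))
    (hcolon : HasLinearSyzygies (colonModule (Ideal.span (Set.range g)) f)) :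
    HasLinearSyzygies (LinearMap.ker (Fintype.linearCombination (MvPolynomial σ K)
      (Sum.elim g fun _ : Unit => f))) := by
  have hsum : ∀ (v : ι → MvPolynomial σ K) (w : Unit → MvPolynomial σ K),
      ∑ x, Sum.elim v w x • (Sum.elim g (fun _ : Unit => f) x : MvPolynomial σ K)
        = ∑ i, v i * g i + w () * f := by
    intro v w
    simp [Fintype.sum_sum_type]
  refine (IsLinearExtension.mk ι Unit _ _ _ hsyz hcolon (fun v => ?_) (fun v w h => ?_)
    fun w hw hdeg => ?_).hasLinearSyzygies
  · rw [mem_ker_linearCombination, mem_ker_linearCombination, hsum]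
    simp
  · rw [mem_ker_linearCombination, hsum] at h
    rw [mem_colonModule, eq_neg_of_add_eq_zero_right h]
    exact neg_mem (Ideal.sum_mem _ fun i _ => Ideal.mul_mem_left _ _ (Ideal.subset_span ⟨i, rfl⟩))
  · rw [mem_colonModule] at hw
    obtain ⟨c, hc⟩ := (Submodule.mem_span_range_iff_exists_fun _).1 hw
    obtain ⟨v, hv, -, hvw⟩ := exists_homogeneous_lift (M := fun (_ : Unit) i => g i)
      (fun _ => hg) (v := fun u => w u * f) (e := 1) (fun u => (hdeg u).mul hf)
      ⟨c, by
        ext1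
        rw [← hc]
        exact Finset.sum_congr rfl fun k _ => by rw [smul_eq_mul, mul_comm]⟩
    refine ⟨-v, fun a => (hv a).neg, ?_⟩
    rw [mem_ker_linearCombination, hsum, congrFun hvw ()]
    simp [mul_comm]

lemma HasLinearSyzygies.colonModule_one {ι : Type} [Fintype ι] {g : ι → MvPolynomial σ K}
    (hg : ∀ i, (g i).IsHomogeneous 1)
    (hsyz : HasLinearSyzygies (LinearMap.ker (Fintype.linearCombination (MvPolynomial σ K) g))) :
    HasLinearSyzygies (colonModule (Ideal.span (Set.range g)) 1) := by
  refine .of_generators (fun i (_ : Unit) => g i) (fun i _ => hg i) ?_ ?_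
  · ext w
    rw [mem_colonModule, mul_one, Ideal.span,
      Submodule.mem_span_range_iff_exists_fun (MvPolynomial σ K),
      Submodule.mem_span_range_iff_exists_fun (MvPolynomial σ K)]
    refine exists_congr fun c => ?_
    rw [_root_.funext_iff]
    simp only [Finset.sum_apply, Pi.smul_apply, smul_eq_mul]
    exact ⟨fun h _ => h, fun h => h ()⟩
  · convert hsyz using 1
    ext w
    rw [mem_ker_linearCombination, mem_ker_linearCombination, _root_.funext_iff]
    simp [Finset.sum_apply]

lemma hasLinearSyzygies_of_isEmpty {ι : Type} [Fintype ι] [IsEmpty ι]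
    (N : Submodule (MvPolynomial σ K) (ι → MvPolynomial σ K)) : HasLinearSyzygies N := by
  refine ⟨fun κ _ _ => IsEmpty κ, ‹_›, fun κ _ L hκ => ⟨Empty, inferInstance, fun _ _ => 0, ?_, ?_,
    inferInstance⟩⟩
  · exact fun a => a.elim
  · exact Subsingleton.elim _ _

lemma mem_span_X_of_mul_X_mem {A : Set σ} {j : σ} (hj : j ∉ A) {f : MvPolynomial σ K}
    (h : f * X j ∈ Ideal.span ((X : σ → MvPolynomial σ K) '' A)) :
    f ∈ Ideal.span ((X : σ → MvPolynomial σ K) '' A) := by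
  classical
  rw [mem_ideal_span_X_image] at h ⊢
  intro m hm
  obtain ⟨i, hi, hmi⟩ := h (m + Finsupp.single j 1) (by
    rw [mem_support_iff, coeff_mul_X]; exact mem_support_iff.1 hm)
  refine ⟨i, hi, ?_⟩
  have hij : i ≠ j := fun h => hj (h ▸ hi)
  rwa [Finsupp.add_apply, Finsupp.single_eq_of_ne hij, add_zero] at hmi

lemma exists_variables_linear_syzygies (A : Finset σ) :
    ∃ (ι : Type) (_ : Fintype ι) (g : ι → MvPolynomial σ K),
      (∀ i, (g i).IsHomogeneous 1) ∧ Set.range g = X '' (A : Set σ) ∧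
      HasLinearSyzygies (LinearMap.ker (Fintype.linearCombination (MvPolynomial σ K) g)) := by
  classical
  induction A using Finset.induction with
  | empty => exact ⟨Empty, inferInstance, fun _ => 0, fun i => i.elim, by simp [Set.range_eq_empty],
      hasLinearSyzygies_of_isEmpty _⟩
  | insert j A hj ih =>
    obtain ⟨ι, _, g, hg, hgA, hsyz⟩ := ih
    refine ⟨ι ⊕ Unit, inferInstance, Sum.elim g fun _ => X j, ?_, ?_,
      .sumElim hg (isHomogeneous_X K j) hsyz ?_⟩
    · rintro (i | i)
      exacts [hg i, isHomogeneous_X K j]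
    · rw [Set.Sum.elim_range, hgA, Set.range_const, Finset.coe_insert, Set.image_insert_eq,
        Set.union_singleton]
    · convert HasLinearSyzygies.colonModule_one hg hsyz using 1
      ext w
      rw [mem_colonModule, mem_colonModule, hgA, mul_one]
      exact ⟨mem_span_X_of_mul_X_mem (by simpa using hj), fun h => Ideal.mul_mem_right _ _ h⟩

lemma hasLinearSyzygies_colonModule [Finite σ] {J : Ideal (MvPolynomial σ K)}
    {f : MvPolynomial σ K} {s : Set σ}
    (h : ∀ w, w * f ∈ J ↔ w ∈ Ideal.span ((X : σ → MvPolynomial σ K) '' s)) :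
    HasLinearSyzygies (colonModule J f) := by
  obtain ⟨ι, _, g, hg, hgA, hsyz⟩ := exists_variables_linear_syzygies (K := K)
    (Set.toFinite s).toFinset
  convert HasLinearSyzygies.colonModule_one hg hsyz using 1
  ext w
  rw [mem_colonModule, mem_colonModule, hgA, h, mul_one, Set.Finite.coe_toFinset]

/-- Generators with colon ideals generated by variables have linear syzygies. -/
theorem exists_linear_syzygies_of_colon [Finite σ] {d m : ℕ} {f : Fin m → MvPolynomial σ K}
    (hf : ∀ i, (f i).IsHomogeneous d)
    (hcolon : ∀ i, ∃ s : Set σ, ∀ w, w * f i ∈ Ideal.span (f '' {j | j < i}) ↔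
      w ∈ Ideal.span ((X : σ → MvPolynomial σ K) '' s)) (k : ℕ) (hk : k ≤ m) :
    ∃ (ι : Type) (_ : Fintype ι) (g : ι → MvPolynomial σ K),
      (∀ i, (g i).IsHomogeneous d) ∧ Set.range g = f '' {j | j.1 < k} ∧
      HasLinearSyzygies (LinearMap.ker (Fintype.linearCombination (MvPolynomial σ K) g)) := by
  induction k with
  | zero => exact ⟨Empty, inferInstance, fun _ => 0, fun i => i.elim, by simp [Set.range_eq_empty],
      hasLinearSyzygies_of_isEmpty _⟩
  | succ k ih =>
    obtain ⟨ι, _, g, hg, hgA, hsyz⟩ := ih (by omega)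
    obtain ⟨s, hs⟩ := hcolon ⟨k, hk⟩
    refine ⟨ι ⊕ Unit, inferInstance, Sum.elim g fun _ => f ⟨k, hk⟩, ?_, ?_,
      .sumElim hg (hf _) hsyz (hasLinearSyzygies_colonModule (s := s) fun w => ?_)⟩
    · rintro (i | i)
      exacts [hg i, hf _]
    · rw [Set.Sum.elim_range, hgA, Set.range_const, ← Set.image_singleton, ← Set.image_union]
      congr 1
      ext j
      simp only [Set.mem_union, Set.mem_ofPred_eq, Set.mem_singleton_iff, Fin.ext_iff]
      omega
    · rw [hgA]
      exact hs w

/-- The index types of a resolution may be arbitrary finite types. -/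
lemma hasLinearResolution_of_fintype {I : Ideal (MvPolynomial σ K)} {d : ℕ} (ι : ℕ → Type)
    [∀ i, Fintype (ι i)] (g : ι 0 → MvPolynomial σ K)
    (M : (i : ℕ) → ι i → ι (i + 1) → MvPolynomial σ K) (hg : ∀ j, (g j).IsHomogeneous d)
    (hI : I = Ideal.span (Set.range g)) (hM : ∀ i j k, (M i j k).IsHomogeneous 1)
    (h0 : ∀ v : ι 0 → MvPolynomial σ K, (∑ j, v j * g j) = 0 ↔
      ∃ w : ι 1 → MvPolynomial σ K, v = fun j => ∑ k, M 0 j k * w k)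
    (hex : ∀ (i : ℕ) (v : ι (i + 1) → MvPolynomial σ K),
      ((fun j => ∑ k, M i j k * v k) = fun _ => 0) ↔
        ∃ w : ι (i + 2) → MvPolynomial σ K, v = fun k => ∑ l, M (i + 1) k l * w l) :
    HasLinearResolution I d := by
  let e (i : ℕ) : Fin (Fintype.card (ι i)) ≃ ι i := (Fintype.equivFin (ι i)).symm
  have hcomp : ∀ i (v : Fin (Fintype.card (ι i)) → MvPolynomial σ K),
      ∃ v' : ι i → MvPolynomial σ K, v = v' ∘ e i := fun i v => ⟨v ∘ (e i).symm, by
    ext1 x; simp⟩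
  have hsum : ∀ i (a : ι i → MvPolynomial σ K) (w : ι i → MvPolynomial σ K),
      ∑ k, a (e i k) * w (e i k) = ∑ k, a k * w k := fun i a w =>
    (e i).sum_comp fun k => a k * w k
  have himage : ∀ i (v : ι i → MvPolynomial σ K),
      (∃ w : Fin (Fintype.card (ι (i + 1))) → MvPolynomial σ K,
        v ∘ e i = fun j => ∑ k, M i (e i j) (e (i + 1) k) * w k) ↔
      ∃ w : ι (i + 1) → MvPolynomial σ K, v = fun j => ∑ k, M i j k * w k := by
    intro i v
    constructor
    · rintro ⟨w, hw⟩
      obtain ⟨w, rfl⟩ := hcomp _ w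
      refine ⟨w, ?_⟩
      ext1 j
      obtain ⟨j, rfl⟩ := (e i).surjective j
      exact (congrFun hw j).trans (hsum (i + 1) (M i (e i j)) w)
    · rintro ⟨w, rfl⟩
      refine ⟨w ∘ e (i + 1), ?_⟩
      ext1 j
      exact (hsum (i + 1) (M i (e i j)) w).symm
  refine ⟨fun i => Fintype.card (ι i), g ∘ e 0, fun i j k => M i (e i j) (e (i + 1) k),
    fun j => hg _, ?_, fun i j k => hM _ _ _, fun v => ?_, fun i v => ?_⟩
  · rw [hI, (e 0).surjective.range_comp]
  · obtain ⟨v, rfl⟩ := hcomp _ v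
    rw [himage, ← h0 v, ← hsum 0 v g]
    rfl
  · obtain ⟨v, rfl⟩ := hcomp _ v
    rw [himage, ← hex i v, _root_.funext_iff, _root_.funext_iff, ← (e i).forall_congr_right]
    refine forall_congr' fun j => ?_
    rw [← hsum (i + 1) (M i (e i j)) v]
    rfl

/-- A module with linear syzygies over a finite free module. -/
structure LinearStage (σ K : Type*) [Field K] where
  /-- The index type of the ambient free module. -/
  index : Type
  [fintype : Fintype index]
  /-- The module. -/
  carrier : Submodule (MvPolynomial σ K) (index → MvPolynomial σ K)
  hasLinearSyzygies : HasLinearSyzygies carrier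

attribute [instance] LinearStage.fintype

theorem hasLinearResolution_of_hasLinearSyzygies {ι : Type} [Fintype ι] {d : ℕ}
    {g : ι → MvPolynomial σ K} (hg : ∀ i, (g i).IsHomogeneous d)
    (hsyz : HasLinearSyzygies (LinearMap.ker (Fintype.linearCombination (MvPolynomial σ K) g))) :
    HasLinearResolution (Ideal.span (Set.range g)) d := by
  have hnext : ∀ x : LinearStage σ K, ∃ (y : LinearStage σ K)
      (h : y.index → x.index → MvPolynomial σ K), (∀ a b, (h a b).IsHomogeneous 1) ∧
        x.carrier = Submodule.span (MvPolynomial σ K) (Set.range h) ∧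
        y.carrier = LinearMap.ker (Fintype.linearCombination (MvPolynomial σ K) h) := by
    intro x
    obtain ⟨μ, _, h, h1, h2, h3⟩ := x.hasLinearSyzygies.exists_generators
    exact ⟨⟨μ, _, h3⟩, h, h1, h2, rfl⟩
  choose next h hlin hspan hker using hnext
  let stage (i : ℕ) : LinearStage σ K := Nat.rec ⟨ι, _, hsyz⟩ (fun _ x => next x) i
  have himage : ∀ (x : LinearStage σ K) (v : x.index → MvPolynomial σ K), v ∈ x.carrier ↔
      ∃ w : (next x).index → MvPolynomial σ K, v = fun j => ∑ k, h x k j * w k := by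
    intro x v
    rw [hspan, Submodule.mem_span_range_iff_exists_fun (MvPolynomial σ K)]
    refine exists_congr fun w => eq_comm.trans (Eq.congr_right ?_)
    ext1 j
    simp [Finset.sum_apply, mul_comm]
  refine @hasLinearResolution_of_fintype σ K _ _ d (fun i => (stage i).index)
    (fun i => (stage i).fintype) g
    (fun i j k => h (stage i) k j) hg rfl (fun i j k => hlin _ _ _) (fun v => ?_) fun i v => ?_
  · exact (mem_ker_linearCombination (h := g)).symm.trans (himage (stage 0) v)
  · refine Iff.trans ?_ (himage (stage (i + 1)) v)
    rw [show (stage (i + 1)).carrier = _ from hker (stage i), mem_ker_linearCombination]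
    refine Eq.congr_left ?_
    ext1 j
    simp only [Finset.sum_apply, Pi.smul_apply, smul_eq_mul]
    exact Finset.sum_congr rfl fun _ _ => mul_comm _ _

end LinearSyzygies

section LinearQuotients

variable {σ K : Type*} [Field K]

lemma hasMonomialMembers_span_monomial (A : Set (σ →₀ ℕ)) :
    HasMonomialMembers (Ideal.span ((fun a => (monomial a (1 : K) : MvPolynomial σ K)) '' A)) := by
  classical
  intro f hf m hm
  obtain ⟨a, ha, hle⟩ := mem_ideal_span_monomial_image.1 hf m (mem_support_iff.2 hm)
  refine mem_ideal_span_monomial_image.2 fun b hb => ⟨a, ha, ?_⟩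
  rw [support_monomial, if_neg one_ne_zero, Finset.mem_singleton] at hb
  exact hb ▸ hle

lemma exists_eq_single_add_single {a : σ →₀ ℕ} (ha : a.degree = 2) :
    ∃ p q, a = Finsupp.single p 1 + Finsupp.single q 1 := by
  have hpos : ∀ {b : σ →₀ ℕ}, b.degree ≠ 0 → ∃ p c, b = Finsupp.single p 1 + c := by
    intro b hb
    obtain ⟨p, hp⟩ := Finsupp.ne_iff.1 (fun h => hb (Finsupp.degree_eq_zero_iff b |>.2 h))
    refine ⟨p, b - Finsupp.single p 1, (add_tsub_cancel_of_le ?_).symm⟩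
    exact Finsupp.single_le_iff.2 (Nat.one_le_iff_ne_zero.2 hp)
  obtain ⟨p, b, rfl⟩ := hpos (b := a) (by omega)
  rw [map_add, Finsupp.degree_single] at ha
  obtain ⟨q, c, rfl⟩ := hpos (b := b) (by omega)
  rw [map_add, Finsupp.degree_single] at ha
  obtain rfl : c = 0 := (Finsupp.degree_eq_zero_iff c).1 (by omega)
  exact ⟨p, q, by rw [add_zero]⟩

lemma edgeProducts_zero (E : σ → σ → Prop) : edgeProducts E 0 = {0} := by
  ext a
  simp only [edgeProducts, Set.mem_ofPred_eq, Set.mem_singleton_iff, Multiset.card_eq_zero]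
  exact ⟨fun ⟨s, hs, _, h⟩ => by simp [h, hs], fun h => ⟨0, rfl, by simp, by simp [h]⟩⟩

lemma mem_edgeProducts_succ {E : σ → σ → Prop} {k : ℕ} {a : σ →₀ ℕ} :
    a ∈ edgeProducts E (k + 1) ↔ ∃ b ∈ edgeProducts E k, ∃ p q, E p q ∧
      a = b + (Finsupp.single p 1 + Finsupp.single q 1) := by
  constructor
  · rintro ⟨s, hs, hE, rfl⟩
    obtain ⟨e, he⟩ := Multiset.card_pos_iff_exists_mem.1 (by omega : 0 < s.card)
    obtain ⟨s, rfl⟩ := Multiset.exists_cons_of_mem he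
    rw [Multiset.card_cons, Nat.succ_inj] at hs
    refine ⟨_, ⟨s, hs, fun p hp => hE p (Multiset.mem_cons_of_mem hp), rfl⟩, e.1, e.2,
      hE e (Multiset.mem_cons_self e s), ?_⟩
    rw [edgeSum_cons, add_comm]
  · rintro ⟨_, ⟨s, hs, hE, rfl⟩, p, q, hpq, rfl⟩
    refine ⟨(p, q) ::ₘ s, by simp [hs], ?_, by rw [edgeSum_cons, add_comm]⟩
    intro e he
    rcases Multiset.mem_cons.1 he with rfl | he
    exacts [hpq, hE e he]

lemma degree_of_mem_edgeProducts {E : σ → σ → Prop} {k : ℕ} {a : σ →₀ ℕ}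
    (ha : a ∈ edgeProducts E k) : a.degree = 2 * k := by
  obtain ⟨s, rfl, -, rfl⟩ := ha
  exact degree_edgeSum (fun e => by simp) s

/-- The powers of an ideal generated by quadratic monomials. -/
lemma pow_eq_span_edgeProducts {I : Ideal (MvPolynomial σ K)} {A : Set (σ →₀ ℕ)}
    (hA : ∀ a ∈ A, a.degree = 2)
    (hI : I = Ideal.span ((fun a => (monomial a (1 : K) : MvPolynomial σ K)) '' A)) (k : ℕ) :
    I ^ k = Ideal.span ((fun a => (monomial a (1 : K) : MvPolynomial σ K)) ''
      edgeProducts (fun p q => (X p * X q : MvPolynomial σ K) ∈ I) k) := by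
  induction k with
  | zero => simp [edgeProducts_zero]
  | succ k ih =>
    apply le_antisymm
    · rw [pow_succ, ih]
      nth_rw 2 [hI]
      rw [Ideal.span_mul_span', Ideal.span_le]
      rintro _ ⟨_, ⟨b, hb, rfl⟩, _, ⟨a, ha, rfl⟩, rfl⟩
      obtain ⟨p, q, rfl⟩ := exists_eq_single_add_single (hA a ha)
      refine Ideal.subset_span ⟨_, mem_edgeProducts_succ.2 ⟨b, hb, p, q, ?_, rfl⟩, ?_⟩
      · rw [← monomial_single_add_single, hI]
        exact Ideal.subset_span ⟨_, ha, rfl⟩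
      · simp [monomial_mul]
    · rw [Ideal.span_le]
      rintro _ ⟨_, ha, rfl⟩
      obtain ⟨b, hb, p, q, hpq, rfl⟩ := mem_edgeProducts_succ.1 ha
      have h : (monomial (b + (Finsupp.single p 1 + Finsupp.single q 1)) (1 : K)) =
          monomial b 1 * (X p * X q) := by
        rw [← monomial_single_add_single, monomial_mul, one_mul]
      simp only [h, pow_succ, SetLike.mem_coe]
      refine Ideal.mul_mem_mul ?_ hpq
      rw [ih]
      exact Ideal.subset_span ⟨b, hb, rfl⟩

/-- Monomials satisfying the exchange property have colon ideals generated by variables. -/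
lemma mul_monomial_mem_span_iff {m : ℕ} {u : Fin m → σ →₀ ℕ} {i : Fin m}
    (hu : ∀ j < i, ∃ j' < i, ∃ l r, u i l < u j l ∧
      u j' + Finsupp.single r 1 = u i + Finsupp.single l 1) (w : MvPolynomial σ K) :
    w * monomial (u i) 1 ∈
        Ideal.span ((fun j => (monomial (u j) (1 : K) : MvPolynomial σ K)) '' {j | j < i}) ↔
      w ∈ Ideal.span ((X : σ → MvPolynomial σ K) ''
        {l | ∃ j < i, u j ≤ u i + Finsupp.single l 1}) := by
  classical
  have himage : (fun j => (monomial (u j) (1 : K) : MvPolynomial σ K)) '' {j | j < i} =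
      (fun a => monomial a 1) '' (u '' {j | j < i}) := by rw [Set.image_image]
  rw [himage, mem_ideal_span_monomial_image, mem_ideal_span_X_image]
  constructor
  · intro h a ha
    obtain ⟨_, ⟨j, hj, rfl⟩, hle⟩ := h (a + u i) (by
      rw [mem_support_iff, coeff_mul_monomial, mul_one]; exact mem_support_iff.1 ha)
    obtain ⟨j', hj', l, r, hl, hr⟩ := hu j hj
    refine ⟨l, ⟨j', hj', hr ▸ le_self_add⟩, ?_⟩
    have := hle l
    rw [Finsupp.add_apply] at this
    omega
  · intro h a ha
    rw [mem_support_iff, coeff_mul_monomial', mul_one] at ha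
    split_ifs at ha with hle
    · obtain ⟨l, ⟨j, hj, hjl⟩, hl⟩ := h _ (mem_support_iff.2 ha)
      refine ⟨u j, ⟨j, hj, rfl⟩, hjl.trans ?_⟩
      have : Finsupp.single l 1 ≤ a - u i :=
        Finsupp.single_le_iff.2 (Nat.one_le_iff_ne_zero.2 hl)
      exact (add_le_add_right this (u i)).trans_eq (add_tsub_cancel_of_le hle)
    · exact absurd rfl ha

end LinearQuotients

/-- **Herzog–Hibi–Zheng.** If a quadratic monomial ideal `I` has a linear resolution,
then every power `I^k` (`k ≥ 1`) has linear quotients; in particular `I^k` has a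
`2k`-linear resolution. -/
theorem herzog_hibi_zheng {K : Type*} [Field K] {n : ℕ}
    (I : Ideal (MvPolynomial (Fin n) K))
    (hquad : ∃ A : Set (Fin n →₀ ℕ), (∀ a ∈ A, a.sum (fun _ e => e) = 2) ∧
      I = Ideal.span ((fun a => (monomial a (1 : K) : MvPolynomial (Fin n) K)) '' A))
    (hlin : HasLinearResolution I 2) :
    ∀ k : ℕ, 1 ≤ k →
      HasLinearQuotients (I ^ k) ∧ HasLinearResolution (I ^ k) (2 * k) := by
  obtain ⟨A, hA, hI⟩ := hquad
  have hmon : HasMonomialMembers I := hI ▸ hasMonomialMembers_span_monomial A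
  let E (p q : Fin n) : Prop := (X p * X q : MvPolynomial (Fin n) K) ∈ I
  have hsymm : ∀ p q, E p q → E q p := fun p q h => by simpa only [E, mul_comm] using h
  obtain ⟨ρ, hρ, hE⟩ := exists_elimination_rank (E := E) hsymm
    (fun i j k => hlin.mul_mem_of_sq_mem hmon i j k) (hlin.hasSeparatingFunctions hmon)
  intro k _
  obtain ⟨m, u, hinj, hrange, hu⟩ :=
    @exists_ordering_edgeProducts (Fin n) (LinearOrder.lift' ρ hρ) _ E hsymm hE k
  have hdeg : ∀ i, (u i).degree = 2 * k := fun i =>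
    degree_of_mem_edgeProducts (hrange ▸ Set.mem_range_self i)
  have hspan : I ^ k = Ideal.span
      (Set.range fun i => (monomial (u i) (1 : K) : MvPolynomial (Fin n) K)) := by
    rw [pow_eq_span_edgeProducts (fun a ha => hA a ha) hI, ← hrange, ← Set.range_comp]
    rfl
  have hcolon := fun i (w : MvPolynomial (Fin n) K) =>
    mul_monomial_mem_span_iff (fun j hj => hu i j hj) w
  refine ⟨⟨m, u, fun i j hij => hinj ?_, hspan, fun i =>
    ⟨{l | ∃ j < i, u j ≤ u i + Finsupp.single l 1}, ?_⟩⟩, ?_⟩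
  · obtain ⟨c, hc⟩ := le_iff_exists_add.1 hij
    have h := congrArg Finsupp.degree hc
    rw [map_add, hdeg, hdeg] at h
    rw [hc, (Finsupp.degree_eq_zero_iff c).1 (by omega), add_zero]
  · ext w
    rw [Ideal.mem_colon_span_singleton]
    exact hcolon i w
  · obtain ⟨ι, _, g, hg, hgrange, hsyz⟩ := exists_linear_syzygies_of_colon
      (fun i => isHomogeneous_monomial (1 : K) (hdeg i)) (fun i => ⟨_, hcolon i⟩) m le_rfl
    rw [hspan]
    convert hasLinearResolution_of_hasLinearSyzygies hg hsyz using 2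
    rw [hgrange]
    simp
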